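/- arXiv:2304.14689 — 3 statements merged into one kernel-verified Lean document; each statement's English description precedes it below -/
import Mathlib

section
/- Let d ≥ 1 and let E₁₁, E₁₂, E₂₁, E₂₂ be real d×d matrices such that E₁₂ and E₂₂ are invertible and the block matrix E = [[E₁₁,E₁₂],[E₂₁,E₂₂]] is invertible. For x, ξ ∈ ℝᵈ define the operator σ_E(x,ξ) on functions h : ℝᵈ → ℂ by σ_E(x,ξ)h(t) = |det E|^{-1/2} |det E₁₂| · e^{2πi ξ·(E₁₂^{-1}E₁₁x)} · e^{-2πi (E₁₂^{-T}ξ)·(E₁₂E₂₂^{-1}t + (E₁₁ − E₁₂E₂₂^{-1}E₂₁)x)} · h(E₁₂E₂₂^{-1}t + (E₁₁ − E₁₂E₂₂^{-1}E₂₁)x). Then σ_E(x,ξ) is a two-sided inverse of the metaplectic atom π_E(x,ξ): for every function g : ℝᵈ → ℂ and every t ∈ ℝᵈ, σ_E(x,ξ)(π_E(x,ξ)g)(t) = g(t) and π_E(x,ξ)(σ_E(x,ξ)g)(t) = g(t). -/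
open MeasureTheory Matrix

/-- The metaplectic atom
`π_E(x,ξ)g(t) = |det E|^{1/2}|det E₁₂|⁻¹ e^{-2πi ξ·(E₁₂⁻¹E₁₁x)} e^{2πi (E₁₂^{-T}ξ)·t}
  g(E₂₂E₁₂⁻¹(t − (E₁₁ − E₁₂E₂₂⁻¹E₂₁)x))`. -/
noncomputable def piE {d : ℕ} (E11 E12 E21 E22 : Matrix (Fin d) (Fin d) ℝ)
    (g : (Fin d → ℝ) → ℂ) (x ξ t : Fin d → ℝ) : ℂ :=
  ((Real.sqrt |(Matrix.fromBlocks E11 E12 E21 E22).det| * |E12.det|⁻¹ : ℝ) : ℂ) *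
    Complex.exp (-2 * Real.pi * Complex.I * ((ξ ⬝ᵥ (E12⁻¹ *ᵥ (E11 *ᵥ x)) : ℝ) : ℂ)) *
    Complex.exp (2 * Real.pi * Complex.I * (((E12ᵀ)⁻¹ *ᵥ ξ) ⬝ᵥ t : ℝ)) *
    g ((E22 * E12⁻¹) *ᵥ (t - (E11 - E12 * E22⁻¹ * E21) *ᵥ x))

/-- The candidate inverse `σ_E(x,ξ)` of the metaplectic atom `π_E(x,ξ)`. -/
noncomputable def sigmaE {d : ℕ} (E11 E12 E21 E22 : Matrix (Fin d) (Fin d) ℝ)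
    (h : (Fin d → ℝ) → ℂ) (x ξ t : Fin d → ℝ) : ℂ :=
  (((Real.sqrt |(Matrix.fromBlocks E11 E12 E21 E22).det|)⁻¹ * |E12.det| : ℝ) : ℂ) *
    Complex.exp (2 * Real.pi * Complex.I * ((ξ ⬝ᵥ (E12⁻¹ *ᵥ (E11 *ᵥ x)) : ℝ) : ℂ)) *
    Complex.exp (-2 * Real.pi * Complex.I *
      ((((E12ᵀ)⁻¹ *ᵥ ξ) ⬝ᵥ
        ((E12 * E22⁻¹) *ᵥ t + (E11 - E12 * E22⁻¹ * E21) *ᵥ x) : ℝ) : ℂ)) *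
    h ((E12 * E22⁻¹) *ᵥ t + (E11 - E12 * E22⁻¹ * E21) *ᵥ x)

theorem mul_inv_mulVec_mul_inv_mulVec {n R : Type*} [Fintype n] [DecidableEq n] [CommRing R]
    {A B : Matrix n n R} (hA : IsUnit A) (hB : IsUnit B) (v : n → R) :
    (A * B⁻¹) *ᵥ ((B * A⁻¹) *ᵥ v) = v := by
  rw [Matrix.isUnit_iff_isUnit_det] at hA hB
  rw [Matrix.mulVec_mulVec, Matrix.mul_assoc, Matrix.nonsing_inv_mul_cancel_left B _ hB,
    Matrix.mul_nonsing_inv A hA, Matrix.one_mulVec]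

/-- The scalar prefactors of `piE` and `sigmaE` are inverse to each other. -/
theorem amplitude_mul_phase_mul_inverse {s D : ℝ} (hs : s ≠ 0) (hD : D ≠ 0) (a b : ℂ) :
    (((s * D⁻¹ : ℝ) : ℂ) * Complex.exp (-2 * Real.pi * Complex.I * a) *
        Complex.exp (2 * Real.pi * Complex.I * b)) *
      (((s⁻¹ * D : ℝ) : ℂ) * Complex.exp (2 * Real.pi * Complex.I * a) *
        Complex.exp (-2 * Real.pi * Complex.I * b)) = 1 := by
  have hsD : ((s * D⁻¹ : ℝ) : ℂ) * ((s⁻¹ * D : ℝ) : ℂ) = 1 := by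
    norm_cast
    field_simp
  have hexp (c : ℂ) : Complex.exp (-2 * Real.pi * Complex.I * c) *
      Complex.exp (2 * Real.pi * Complex.I * c) = 1 := by
    rw [← Complex.exp_add]
    simp
  rw [mul_mul_mul_comm, mul_mul_mul_comm ((s * D⁻¹ : ℝ) : ℂ), hsD, hexp a, one_mul, one_mul,
    mul_comm, hexp b]

theorem sigmaE_two_sided_inverse_of_piE {d : ℕ} (hd : 1 ≤ d)
    (E11 E12 E21 E22 : Matrix (Fin d) (Fin d) ℝ)
    (h12 : IsUnit E12) (h22 : IsUnit E22)
    (hE : IsUnit (Matrix.fromBlocks E11 E12 E21 E22))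
    (x ξ : Fin d → ℝ) (g : (Fin d → ℝ) → ℂ) (t : Fin d → ℝ) :
    sigmaE E11 E12 E21 E22 (piE E11 E12 E21 E22 g x ξ) x ξ t = g t ∧
    piE E11 E12 E21 E22 (sigmaE E11 E12 E21 E22 g x ξ) x ξ t = g t := by
  have hs : Real.sqrt |(Matrix.fromBlocks E11 E12 E21 E22).det| ≠ 0 :=
    (Real.sqrt_pos.2 (abs_pos.2 ((Matrix.isUnit_iff_isUnit_det _).1 hE).ne_zero)).ne'
  have hD : |E12.det| ≠ 0 := abs_ne_zero.2 ((Matrix.isUnit_iff_isUnit_det _).1 h12).ne_zero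
  constructor
  · simp only [sigmaE, piE, add_sub_cancel_right, mul_inv_mulVec_mul_inv_mulVec h22 h12]
    rw [← mul_assoc, mul_comm (_ * _ * _) (_ * _ * _),
      amplitude_mul_phase_mul_inverse hs hD, one_mul]
  · simp only [sigmaE, piE, mul_inv_mulVec_mul_inv_mulVec h12 h22, sub_add_cancel]
    rw [← mul_assoc, amplitude_mul_phase_mul_inverse hs hD, one_mul]
end

section
/- Let d ≥ 1 and let E₁₁, E₁₂, E₂₁, E₂₂ be real d×d matrices such that E₁₂ and E₂₂ are invertible and the block matrix E = [[E₁₁,E₁₂],[E₂₁,E₂₂]] is invertible. Then for all Schwartz functions f, g on ℝᵈ, the function (x,ξ) ↦ W_E(f,g)(x,ξ) is (equal to) a Schwartz function on ℝ^{2d}. -/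
open MeasureTheory Matrix

/-- The totally Wigner-decomposable metaplectic Wigner distribution
`W_E(f,g)(x,ξ) = |det E|^{1/2} ∫ f(E₁₁x + E₁₂t) conj(g(E₂₁x + E₂₂t)) e^{-2πi ξ·t} dt`. -/
noncomputable def WE {d : ℕ} (E11 E12 E21 E22 : Matrix (Fin d) (Fin d) ℝ)
    (f g : (Fin d → ℝ) → ℂ) (x ξ : Fin d → ℝ) : ℂ :=
  ((Real.sqrt |(Matrix.fromBlocks E11 E12 E21 E22).det| : ℝ) : ℂ) *
    ∫ t : Fin d → ℝ,
      f (E11 *ᵥ x + E12 *ᵥ t) * (starRingEnd ℂ) (g (E21 *ᵥ x + E22 *ᵥ t)) *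
        Complex.exp (-2 * Real.pi * Complex.I * ((ξ ⬝ᵥ t : ℝ) : ℂ))

namespace SchwartzMap

open Real Complex ContinuousLinearMap NormedSpace
open scoped FourierTransform SchwartzMap ContDiff InnerProductSpace

universe u

section PartialFourier

variable {X V G : Type u} [NormedAddCommGroup X] [NormedSpace ℝ X]
  [NormedAddCommGroup V] [InnerProductSpace ℝ V] [FiniteDimensional ℝ V]
  [MeasurableSpace V] [BorelSpace V]
  [NormedAddCommGroup G] [NormedSpace ℝ G]

theorem exists_integrable_bound_slice (F : 𝓢(X × V, G)) :
    ∃ b : V → ℝ, Integrable b ∧ ∀ x t, ‖F (x, t)‖ ≤ b t := by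
  set k := Module.finrank ℝ V + 1 with hk
  set C := 2 ^ k * (Finset.Iic (k, 0)).sup (fun m ↦ SchwartzMap.seminorm ℝ m.1 m.2) F
  refine ⟨fun t ↦ C * (1 + ‖t‖) ^ (-(k : ℝ)),
    (integrable_one_add_norm (by rw [hk]; push_cast; linarith)).const_mul C, fun x t ↦ ?_⟩
  beta_reduce
  have h := one_add_le_sup_seminorm_apply (𝕜 := ℝ) (m := (k, 0)) le_rfl le_rfl F (x, t)
  rw [norm_iteratedFDeriv_zero] at h
  rw [Real.rpow_neg (by positivity), Real.rpow_natCast, ← div_eq_mul_inv,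
    le_div_iff₀ (by positivity), mul_comm]
  refine le_trans ?_ h
  gcongr
  exact norm_snd_le (x, t)

theorem integrable_slice (F : 𝓢(X × V, G)) (x : X) :
    Integrable fun t ↦ F (x, t) := by
  obtain ⟨b, hb, hF⟩ := exists_integrable_bound_slice F
  have hc : Continuous fun t : V ↦ F (x, t) := F.continuous.comp (by fun_prop)
  exact hb.mono' hc.aestronglyMeasurable (.of_forall (hF x))

variable [NormedSpace ℂ G]

/-- The Fourier transform of a Schwartz function in its second variable. -/
noncomputable def partialFourier (F : 𝓢(X × V, G)) (p : X × V) : G :=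
  ∫ t, 𝐞 (-⟪t, p.2⟫_ℝ) • F (p.1, t)

theorem integrable_partialFourier_integrand (F : 𝓢(X × V, G)) (p : X × V) :
    Integrable fun t ↦ 𝐞 (-⟪t, p.2⟫_ℝ) • F (p.1, t) :=
  (fourierIntegral_convergent_iff p.2).2 (integrable_slice F p.1)

omit [FiniteDimensional ℝ V] [MeasurableSpace V] [BorelSpace V] in
theorem norm_partialFourier_integrand (F : 𝓢(X × V, G)) (t : V) (p : X × V) :
    ‖𝐞 (-⟪t, p.2⟫_ℝ) • F (p.1, t)‖ = ‖F (p.1, t)‖ :=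
  Circle.norm_smul _ _

variable [IsScalarTower ℝ ℂ G]

/-- The Schwartz function whose partial Fourier transform is the derivative of that of `F`. -/
noncomputable def partialFourierDeriv (F : 𝓢(X × V, G)) : 𝓢(X × V, X × V →L[ℝ] G) :=
  (fderivCLM ℝ (X × V) G F).postcompCLM ((compL ℝ (X × V) (X × V) G).flip (inl ℝ X V ∘L fst ℝ X V))
    - (2 * π * I) •
      smulRightCLM ℝ G ((innerSL ℝ).bilinearComp (snd ℝ X V) (snd ℝ X V)) F

omit [FiniteDimensional ℝ V] [MeasurableSpace V] [BorelSpace V] in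
theorem hasFDerivAt_partialFourier_integrand (F : 𝓢(X × V, G)) (t : V) (p : X × V) :
    HasFDerivAt (fun p : X × V ↦ 𝐞 (-⟪t, p.2⟫_ℝ) • F (p.1, t))
      (𝐞 (-⟪t, p.2⟫_ℝ) • partialFourierDeriv F (p.1, t)) p := by
  have h1 := hasFDerivAt_fourierChar_neg_bilinear_right
    ((innerSL ℝ).bilinearComp (.id ℝ V) (snd ℝ X V)) t p
  have h2 : HasFDerivAt (fun p : X × V ↦ F (p.1, t))
      (fderiv ℝ F (p.1, t) ∘L (inl ℝ X V ∘L fst ℝ X V)) p := by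
    refine (F.hasFDerivAt (p.1, t)).comp p ?_
    exact (hasFDerivAt_fst (𝕜 := ℝ) (p := p)).prodMk (hasFDerivAt_const t p)
  convert! h1.smul h2 using 1
  ext v
  · simp [partialFourierDeriv, Circle.smul_def]
  · simp [partialFourierDeriv, Circle.smul_def, smul_sub]
    rw [← algebraMap_smul ℂ ⟪t, v⟫_ℝ, coe_algebraMap, smul_smul, smul_smul, sub_eq_add_neg]
    congr 3
    ring

theorem hasFDerivAt_partialFourier (F : 𝓢(X × V, G)) (p : X × V) :
    HasFDerivAt (partialFourier F) (partialFourier (partialFourierDeriv F) p) p := by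
  obtain ⟨b, hb, hF⟩ := exists_integrable_bound_slice (partialFourierDeriv F)
  have hbd (t : V) (q : X × V) : ‖𝐞 (-⟪t, q.2⟫_ℝ) • partialFourierDeriv F (q.1, t)‖ ≤ b t := by
    exact (norm_partialFourier_integrand (partialFourierDeriv F) t q).trans_le (hF q.1 t)
  have h := hasFDerivAt_integral_of_dominated_of_fderiv_le (𝕜 := ℝ) (μ := volume) (x₀ := p)
    (s := Set.univ) (bound := b) (F := fun q t ↦ 𝐞 (-⟪t, q.2⟫_ℝ) • F (q.1, t))
    (F' := fun q t ↦ 𝐞 (-⟪t, q.2⟫_ℝ) • partialFourierDeriv F (q.1, t)) Filter.univ_mem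
    (.of_forall fun q ↦ (integrable_partialFourier_integrand F q).aestronglyMeasurable)
    (integrable_partialFourier_integrand F p)
    (integrable_partialFourier_integrand (partialFourierDeriv F) p).aestronglyMeasurable
    (.of_forall fun t q _ ↦ hbd t q) hb
    (.of_forall fun t q _ ↦ hasFDerivAt_partialFourier_integrand F t q)
  exact h

theorem fderiv_partialFourier (F : 𝓢(X × V, G)) :
    fderiv ℝ (partialFourier F) = partialFourier (partialFourierDeriv F) :=
  funext fun p ↦ (hasFDerivAt_partialFourier F p).fderiv

theorem norm_fst_mul_partialFourier [CompleteSpace G] (F : 𝓢(X × V, G)) (p : X × V) :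
    ‖p.1‖ * ‖partialFourier F p‖ =
      ‖partialFourier (smulRightCLM ℝ G (inclusionInDoubleDual ℝ X ∘L fst ℝ X V) F) p‖ := by
  have h : partialFourier (smulRightCLM ℝ G (inclusionInDoubleDual ℝ X ∘L fst ℝ X V) F) p =
      (inclusionInDoubleDual ℝ X p.1).smulRight (partialFourier F p) := by
    have := ContinuousLinearMap.integral_comp_comm (𝕜 := ℝ) (Fₗ := StrongDual ℝ X →L[ℝ] G)
      (smulRightL ℝ (StrongDual ℝ X) G (inclusionInDoubleDual ℝ X p.1))
      (integrable_partialFourier_integrand F p)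
    simp only [partialFourier]
    refine Eq.trans (integral_congr_ae (.of_forall fun t ↦ ?_)) this
    ext v
    simpa [Circle.smul_def] using smul_comm _ _ _
  rw [h, norm_smulRight_apply]
  congr 1
  exact ((inclusionInDoubleDualLi (E := X) ℝ).norm_map p.1).symm

theorem two_pi_mul_norm_snd_mul_partialFourier (F : 𝓢(X × V, G)) (p : X × V) :
    2 * π * (‖p.2‖ * ‖partialFourier F p‖) =
      ‖partialFourier ((fderivCLM ℝ (X × V) G F).postcompCLM
        ((compL ℝ V (X × V) G).flip (inr ℝ X V))) p‖ := by
  have hd (t : V) : HasFDerivAt (fun t ↦ F (p.1, t)) (fderiv ℝ F (p.1, t) ∘L inr ℝ X V) t := by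
    refine (F.hasFDerivAt (p.1, t)).comp t ?_
    exact (hasFDerivAt_const p.1 t).prodMk (hasFDerivAt_id (𝕜 := ℝ) t)
  have hfd : fderiv ℝ (fun t ↦ F (p.1, t)) = fun t ↦ (fderivCLM ℝ (X × V) G F).postcompCLM
        ((compL ℝ V (X × V) G).flip (inr ℝ X V)) (p.1, t) :=
    funext fun t ↦ (hd t).fderiv
  obtain rfl : ‹NormedSpace ℝ G› = NormedSpace.complexToReal := by
    ext r x
    exact (algebraMap_smul ℂ r x).symm
  have h := congrFun (fourier_fderiv (integrable_slice F p.1)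
    (fun t ↦ (hd t).differentiableAt) (hfd ▸ integrable_slice _ p.1)) p.2
  rw [hfd] at h
  have hp : partialFourier F p = 𝓕 (fun t ↦ F (p.1, t)) p.2 := rfl
  rw [hp]
  refine Eq.trans ?_ (congrArg norm h.symm)
  rw [VectorFourier.norm_fourierSMulRight, show (-innerSL ℝ) p.2 = -innerSL ℝ p.2 from rfl,
    norm_neg, innerSL_apply_norm, ← mul_assoc]

theorem exists_pow_norm_mul_partialFourier_le [CompleteSpace G] (k : ℕ) (F : 𝓢(X × V, G)) :
    ∃ C, ∀ p, ‖p‖ ^ k * ‖partialFourier F p‖ ≤ C := by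
  induction k generalizing G with
  | zero =>
    obtain ⟨b, hb, hF⟩ := exists_integrable_bound_slice F
    refine ⟨∫ t, b t, fun p ↦ ?_⟩
    rw [pow_zero, one_mul, partialFourier]
    exact norm_integral_le_of_norm_le hb
      (.of_forall fun t ↦ (norm_partialFourier_integrand F t p).trans_le (hF p.1 t))
  | succ k ih =>
    obtain ⟨C₁, h₁⟩ := ih (smulRightCLM ℝ G (inclusionInDoubleDual ℝ X ∘L fst ℝ X V) F)
    obtain ⟨C₂, h₂⟩ := ih ((fderivCLM ℝ (X × V) G F).postcompCLM
        ((compL ℝ V (X × V) G).flip (inr ℝ X V)))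
    refine ⟨C₁ + C₂, fun p ↦ ?_⟩
    have h2π : 1 ≤ 2 * π := by linarith [two_le_pi]
    calc ‖p‖ ^ (k + 1) * ‖partialFourier F p‖
        ≤ ‖p‖ ^ k * (‖p.1‖ + 2 * π * ‖p.2‖) * ‖partialFourier F p‖ := by
          rw [pow_succ]
          gcongr
          rw [Prod.norm_def]
          refine max_le (le_add_of_nonneg_right (by positivity)) ?_
          nlinarith [norm_nonneg p.1, norm_nonneg p.2]
      _ = ‖p‖ ^ k * (‖p.1‖ * ‖partialFourier F p‖) +
          ‖p‖ ^ k * (2 * π * (‖p.2‖ * ‖partialFourier F p‖)) := by ring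
      _ ≤ C₁ + C₂ := by
          rw [norm_fst_mul_partialFourier, two_pi_mul_norm_snd_mul_partialFourier]
          exact add_le_add (h₁ p) (h₂ p)

theorem contDiff_partialFourier (n : ℕ) (F : 𝓢(X × V, G)) :
    ContDiff ℝ n (partialFourier F) := by
  induction n generalizing G with
  | zero =>
    exact contDiff_zero.2 (continuous_iff_continuousAt.2 fun p ↦
      (hasFDerivAt_partialFourier F p).continuousAt)
  | succ n ih =>
    rw [Nat.cast_succ, contDiff_succ_iff_fderiv]
    exact ⟨fun p ↦ (hasFDerivAt_partialFourier F p).differentiableAt, by simp,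
      fderiv_partialFourier F ▸ ih (partialFourierDeriv F)⟩

theorem partialFourier_decay [CompleteSpace G] (k n : ℕ) (F : 𝓢(X × V, G)) :
    ∃ C, ∀ p, ‖p‖ ^ k * ‖iteratedFDeriv ℝ n (partialFourier F) p‖ ≤ C := by
  induction n generalizing G with
  | zero => simpa only [norm_iteratedFDeriv_zero] using exists_pow_norm_mul_partialFourier_le k F
  | succ n ih =>
    simpa only [← norm_iteratedFDeriv_fderiv, fderiv_partialFourier] using
      ih (partialFourierDeriv F)

/-- The Fourier transform in the second variable, as a map of the Schwartz space. -/
noncomputable def partialFourierTransform [CompleteSpace G] (F : 𝓢(X × V, G)) :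
    𝓢(X × V, G) where
  toFun := partialFourier F
  smooth' := contDiff_infty.2 fun n ↦ contDiff_partialFourier n F
  decay' k n := partialFourier_decay k n F

end PartialFourier

section Tensor

variable {E₁ E₂ : Type*} [NormedAddCommGroup E₁] [NormedSpace ℝ E₁]
  [NormedAddCommGroup E₂] [NormedSpace ℝ E₂]

theorem norm_iteratedFDeriv_comp_fst_le (f : 𝓢(E₁, ℂ)) (n : ℕ) (p : E₁ × E₂) :
    ‖iteratedFDeriv ℝ n (fun p : E₁ × E₂ ↦ f p.1) p‖ ≤ ‖iteratedFDeriv ℝ n f p.1‖ := by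
  have h := (fst ℝ E₁ E₂).iteratedFDeriv_comp_right (f.smooth ⊤) p (i := n) (mod_cast le_top)
  change iteratedFDeriv ℝ n (fun p : E₁ × E₂ ↦ f p.1) p = _ at h
  rw [h]
  refine (ContinuousMultilinearMap.norm_compContinuousLinearMap_le _ _).trans ?_
  refine mul_le_of_le_one_right (norm_nonneg _) (Finset.prod_le_one (fun _ _ ↦ norm_nonneg _) ?_)
  exact fun _ _ ↦ norm_fst_le ..

theorem norm_iteratedFDeriv_comp_snd_le (f : 𝓢(E₂, ℂ)) (n : ℕ) (p : E₁ × E₂) :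
    ‖iteratedFDeriv ℝ n (fun p : E₁ × E₂ ↦ f p.2) p‖ ≤ ‖iteratedFDeriv ℝ n f p.2‖ := by
  have h := (snd ℝ E₁ E₂).iteratedFDeriv_comp_right (f.smooth ⊤) p (i := n) (mod_cast le_top)
  change iteratedFDeriv ℝ n (fun p : E₁ × E₂ ↦ f p.2) p = _ at h
  rw [h]
  refine (ContinuousMultilinearMap.norm_compContinuousLinearMap_le _ _).trans ?_
  refine mul_le_of_le_one_right (norm_nonneg _) (Finset.prod_le_one (fun _ _ ↦ norm_nonneg _) ?_)
  exact fun _ _ ↦ norm_snd_le ..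

/-- The tensor product of two Schwartz functions. -/
noncomputable def tensor (f : 𝓢(E₁, ℂ)) (g : 𝓢(E₂, ℂ)) : 𝓢(E₁ × E₂, ℂ) where
  toFun p := f p.1 * g p.2
  smooth' := ((f.smooth ⊤).comp contDiff_fst).mul ((g.smooth ⊤).comp contDiff_snd)
  decay' k n := by
    refine ⟨∑ i ∈ Finset.range (n + 1), n.choose i *
      (SchwartzMap.seminorm ℝ k i f * SchwartzMap.seminorm ℝ 0 (n - i) g +
        SchwartzMap.seminorm ℝ 0 i f * SchwartzMap.seminorm ℝ k (n - i) g), fun p ↦ ?_⟩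
    have h := norm_iteratedFDeriv_mul_le (𝕜 := ℝ) (n := n) (N := ∞)
      ((f.smooth ⊤).comp (contDiff_fst (E := E₁) (F := E₂)))
      ((g.smooth ⊤).comp (contDiff_snd (E := E₁) (F := E₂))) p (mod_cast le_top)
    refine (mul_le_mul_of_nonneg_left h (by positivity)).trans ?_
    rw [Finset.mul_sum]
    refine Finset.sum_le_sum fun i _ ↦ ?_
    have hp : ‖p‖ ^ k ≤ ‖p.1‖ ^ k + ‖p.2‖ ^ k := by
      rcases max_cases ‖p.1‖ ‖p.2‖ with ⟨h, -⟩ | ⟨h, -⟩ <;> rw [Prod.norm_def, h] <;>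
        simp [pow_nonneg]
    calc _ ≤ (‖p.1‖ ^ k + ‖p.2‖ ^ k) *
          (n.choose i * ‖iteratedFDeriv ℝ i f p.1‖ * ‖iteratedFDeriv ℝ (n - i) g p.2‖) := by
          gcongr
          · exact norm_iteratedFDeriv_comp_fst_le f i p
          · exact norm_iteratedFDeriv_comp_snd_le g (n - i) p
      _ = n.choose i * ((‖p.1‖ ^ k * ‖iteratedFDeriv ℝ i f p.1‖) *
            ‖iteratedFDeriv ℝ (n - i) g p.2‖ + ‖iteratedFDeriv ℝ i f p.1‖ *
              (‖p.2‖ ^ k * ‖iteratedFDeriv ℝ (n - i) g p.2‖)) := by ring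
      _ ≤ _ := by
          gcongr
          · exact le_seminorm ℝ k i f p.1
          · exact norm_iteratedFDeriv_le_seminorm ℝ g _ _
          · exact norm_iteratedFDeriv_le_seminorm ℝ f _ _
          · exact le_seminorm ℝ k (n - i) g p.2

end Tensor

end SchwartzMap

/-- The linear automorphism `(x, t) ↦ (E₁₁x + E₁₂t, E₂₁x + E₂₂t)` given by an invertible block
matrix. -/
noncomputable def Matrix.fromBlocksEquiv {d : ℕ} {E11 E12 E21 E22 : Matrix (Fin d) (Fin d) ℝ}
    (hE : IsUnit (Matrix.fromBlocks E11 E12 E21 E22)) :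
    ((Fin d → ℝ) × (Fin d → ℝ)) ≃L[ℝ] (Fin d → ℝ) × (Fin d → ℝ) :=
  LinearEquiv.toContinuousLinearEquiv <|
    (LinearEquiv.sumArrowLequivProdArrow (Fin d) (Fin d) ℝ ℝ).symm ≪≫ₗ
      Matrix.toLinearEquiv' _ hE.invertible ≪≫ₗ
      LinearEquiv.sumArrowLequivProdArrow (Fin d) (Fin d) ℝ ℝ

theorem Matrix.fromBlocksEquiv_apply {d : ℕ} {E11 E12 E21 E22 : Matrix (Fin d) (Fin d) ℝ}
    (hE : IsUnit (Matrix.fromBlocks E11 E12 E21 E22)) (x t : Fin d → ℝ) :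
    Matrix.fromBlocksEquiv hE (x, t) = (E11 *ᵥ x + E12 *ᵥ t, E21 *ᵥ x + E22 *ᵥ t) := by
  have h : (LinearEquiv.sumArrowLequivProdArrow (Fin d) (Fin d) ℝ ℝ).symm (x, t) =
    Sum.elim x t := rfl
  have h2 : Matrix.fromBlocksEquiv hE (x, t) =
    LinearEquiv.sumArrowLequivProdArrow (Fin d) (Fin d) ℝ ℝ
      (Matrix.fromBlocks E11 E12 E21 E22 *ᵥ Sum.elim x t) := rfl
  rw [h2, Matrix.fromBlocks_mulVec]
  rfl

theorem WE_schwartz {d : ℕ} (hd : 1 ≤ d)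
    (E11 E12 E21 E22 : Matrix (Fin d) (Fin d) ℝ)
    (h12 : IsUnit E12) (h22 : IsUnit E22)
    (hE : IsUnit (Matrix.fromBlocks E11 E12 E21 E22))
    (f g : SchwartzMap (Fin d → ℝ) ℂ) :
    ∃ h : SchwartzMap ((Fin d → ℝ) × (Fin d → ℝ)) ℂ,
      ∀ x ξ : Fin d → ℝ, WE E11 E12 E21 E22 f g x ξ = h (x, ξ) := by
  let e : ((Fin d → ℝ) × EuclideanSpace ℝ (Fin d)) ≃L[ℝ] (Fin d → ℝ) × (Fin d → ℝ) :=
    (ContinuousLinearEquiv.refl ℝ _).prodCongr (EuclideanSpace.equiv (Fin d) ℝ)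
  let F := SchwartzMap.compCLMOfContinuousLinearEquiv ℝ (e.trans (Matrix.fromBlocksEquiv hE))
    (f.tensor (g.postcompCLM (Complex.conjCLE : ℂ →L[ℝ] ℂ)))
  refine ⟨((Real.sqrt |(Matrix.fromBlocks E11 E12 E21 E22).det| : ℝ) : ℂ) •
    SchwartzMap.compCLMOfContinuousLinearEquiv ℝ e.symm F.partialFourierTransform,
    fun x ξ ↦ congrArg (((Real.sqrt |(Matrix.fromBlocks E11 E12 E21 E22).det| : ℝ) : ℂ) * ·) ?_⟩
  change _ = SchwartzMap.partialFourier F (x, WithLp.toLp 2 ξ)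
  rw [SchwartzMap.partialFourier,
    ← (PiLp.volume_preserving_toLp (Fin d)).integral_comp
      (MeasurableEquiv.toLp 2 (Fin d → ℝ)).measurableEmbedding]
  refine integral_congr_ae (.of_forall fun t ↦ ?_)
  have hF : F (x, WithLp.toLp 2 t) = f (E11 *ᵥ x + E12 *ᵥ t) *
      (starRingEnd ℂ) (g (E21 *ᵥ x + E22 *ᵥ t)) := by
    change f (Matrix.fromBlocksEquiv hE (x, t)).1 *
      (starRingEnd ℂ) (g (Matrix.fromBlocksEquiv hE (x, t)).2) = _
    rw [Matrix.fromBlocksEquiv_apply]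
  simp only [hF, Circle.smul_def, Real.fourierChar_apply, smul_eq_mul,
    EuclideanSpace.inner_toLp_toLp, star_trivial]
  rw [mul_comm]
  congr 2
  push_cast
  ring
end

section
/- Let d ≥ 1, let E₁₁, E₁₂, E₂₁, E₂₂ be real d×d matrices such that E₁₂ and E₂₂ are invertible and the block matrix E = [[E₁₁,E₁₂],[E₂₁,E₂₂]] is invertible, and let C be a real symmetric 2d×2d matrix. Let 1 ≤ p, q < ∞. Let v : ℝ^{2d} → (0,∞) be continuous, even, submultiplicative (v(z+w) ≤ v(z)v(w)) and of polynomial growth (there exist C₀, N > 0 with v(z) ≤ C₀(1+|z|)^N), and let m : ℝ^{2d} → (0,∞) be continuous and v-moderate (there is C₁ > 0 with m(z+w) ≤ C₁ v(z) m(w)). Assume there are c₀, c₁ > 0 such that c₀ m(x,ξ) ≤ m((E₁₁ − E₁₂E₂₂^{-1}E₂₁)x, E₁₂^{-T}ξ) ≤ c₁ m(x,ξ) for all x, ξ ∈ ℝᵈ. Let g₀, g be nonzero Schwartz functions on ℝᵈ. Then there exist A, B > 0 such that for every Schwartz function f on ℝᵈ: A · ‖V_{g₀}f‖_{L^{p,q}_m}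 ≤ ‖W_{C,E}(f,g)‖_{L^{p,q}_m} ≤ B · ‖V_{g₀}f‖_{L^{p,q}_m}. -/
open MeasureTheory Matrix

/-- The short-time Fourier transform `V_γ f(x,ξ) = ∫ f(t) conj(γ(t−x)) e^{-2πi ξ·t} dt`. -/
noncomputable def STFT {d : ℕ} (γ f : (Fin d → ℝ) → ℂ) (x ξ : Fin d → ℝ) : ℂ :=
  ∫ t : Fin d → ℝ,
    f t * (starRingEnd ℂ) (γ (t - x)) *
      Complex.exp (-2 * Real.pi * Complex.I * ((ξ ⬝ᵥ t : ℝ) : ℂ))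

/-- The quadratic form `(Cz)·z` of the chirp, where `z = (x,ξ) ∈ ℝ^{2d}` is encoded as
`Sum.elim x ξ : (Fin d ⊕ Fin d) → ℝ`. -/
noncomputable def chirpQ {d : ℕ} (C : Matrix (Fin d ⊕ Fin d) (Fin d ⊕ Fin d) ℝ)
    (x ξ : Fin d → ℝ) : ℝ :=
  (C *ᵥ Sum.elim x ξ) ⬝ᵥ Sum.elim x ξ

/-- The Wigner-decomposable distribution `W_{C,E}(f,g)(z) = e^{iπ(Cz)·z} W_E(f,g)(z)`. -/
noncomputable def WCE {d : ℕ} (C : Matrix (Fin d ⊕ Fin d) (Fin d ⊕ Fin d) ℝ)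
    (E11 E12 E21 E22 : Matrix (Fin d) (Fin d) ℝ)
    (f g : (Fin d → ℝ) → ℂ) (x ξ : Fin d → ℝ) : ℂ :=
  Complex.exp (Complex.I * Real.pi * (chirpQ C x ξ : ℝ)) * WE E11 E12 E21 E22 f g x ξ

/-- The weighted mixed norm
`‖F‖_{L^{p,q}_m} = (∫_{ℝᵈ} (∫_{ℝᵈ} |F(x,ξ)|^p m(x,ξ)^p dx)^{q/p} dξ)^{1/q}`. -/
noncomputable def mixedNorm {d : ℕ} (p q : ℝ)
    (m : (Fin d → ℝ) × (Fin d → ℝ) → ℝ)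
    (F : (Fin d → ℝ) → (Fin d → ℝ) → ℂ) : ℝ :=
  (∫ ξ : Fin d → ℝ,
      (∫ x : Fin d → ℝ, ‖F x ξ‖ ^ p * m (x, ξ) ^ p) ^ (q / p)) ^ (1 / q)

open scoped SchwartzMap FourierTransform ENNReal RealInnerProductSpace

section FourierSide

variable {V : Type*} [NormedAddCommGroup V] [InnerProductSpace ℝ V]

/-- Pointwise product of Schwartz functions. -/
noncomputable def schwartzMul (f g : 𝓢(V, ℂ)) : 𝓢(V, ℂ) :=
  SchwartzMap.pairing (ContinuousLinearMap.mul ℂ ℂ) f g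

/-- The Schwartz function `t ↦ conj (γ (t - x))`. -/
noncomputable def conjShift (γ : 𝓢(V, ℂ)) (x : V) : 𝓢(V, ℂ) :=
  SchwartzMap.compSubConstCLM ℝ x
    (SchwartzMap.postcompCLM (Complex.conjCLE : ℂ →L[ℝ] ℂ) γ)

@[simp]
lemma schwartzMul_apply (f g : 𝓢(V, ℂ)) (t : V) : schwartzMul f g t = f t * g t := by
  simp [schwartzMul]

@[simp]
lemma conjShift_apply (γ : 𝓢(V, ℂ)) (x t : V) :
    conjShift γ x t = (starRingEnd ℂ) (γ (t - x)) := by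
  simp [conjShift]

/-- A Schwartz function is bounded by every negative power of `1 + ‖x‖`. -/
lemma schwartz_decay (f : 𝓢(V, ℂ)) (N : ℕ) :
    ∃ C, 0 < C ∧ ∀ x, (1 + ‖x‖) ^ N * ‖f x‖ ≤ C := by
  refine ⟨2 ^ N * (Finset.Iic (N, 0)).sup (fun m => SchwartzMap.seminorm ℝ m.1 m.2) f + 1,
    by positivity, fun x => ?_⟩
  have := SchwartzMap.one_add_le_sup_seminorm_apply (𝕜 := ℝ) (m := (N, 0)) le_rfl le_rfl f x
  simp only [norm_iteratedFDeriv_zero] at this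
  linarith

variable [FiniteDimensional ℝ V] [MeasurableSpace V] [BorelSpace V]

lemma fourier_comp_sub (f : V → ℂ) (x ξ : V) :
    ‖𝓕 (fun t => f (t - x)) ξ‖ = ‖𝓕 f ξ‖ := by
  have h := congrFun (VectorFourier.fourierIntegral_comp_add_right Real.fourierChar volume
    (innerₗ V) f (-x)) ξ
  have h' : 𝓕 (fun t => f (t - x)) ξ = Real.fourierChar (innerₗ V (-x) ξ) • 𝓕 f ξ := by
    simp only [sub_eq_add_neg]
    exact h
  rw [h', Circle.norm_smul]

/-- The Fourier transform of a product is the convolution of the Fourier transforms. -/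
lemma fourier_schwartzMul (f g : 𝓢(V, ℂ)) (ξ : V) :
    𝓕 (schwartzMul f g) ξ = ∫ η, 𝓕 f η * 𝓕 g (ξ - η) := by
  have h := SchwartzMap.convolution_apply (ContinuousLinearMap.mul ℂ ℂ) (𝓕⁻ f) (𝓕⁻ g) (-ξ)
  have h1 : SchwartzMap.convolution (ContinuousLinearMap.mul ℂ ℂ) (𝓕⁻ f) (𝓕⁻ g)
      = 𝓕⁻ (schwartzMul f g) := by
    simp [SchwartzMap.convolution, schwartzMul]
  have h2 (k : 𝓢(V, ℂ)) (w : V) : 𝓕⁻ k w = 𝓕 k (-w) := by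
    rw [SchwartzMap.fourierInv_coe, SchwartzMap.fourier_coe, Real.fourierInv_eq_fourier_neg]
  rw [h1, h2, neg_neg, convolution_def] at h
  rw [h, ← integral_neg_eq_self]
  congr 1 with η
  simp only [ContinuousLinearMap.mul_apply', h2, neg_neg]
  congr 2
  abel

/-- The short-time Fourier transform on an inner product space. -/
noncomputable def innerSTFT (γ f : V → ℂ) (x ξ : V) : ℂ :=
  𝓕 (fun t => f t * (starRingEnd ℂ) (γ (t - x))) ξ

lemma innerSTFT_eq_fourier (γ f : 𝓢(V, ℂ)) (x ξ : V) :
    innerSTFT γ f x ξ = 𝓕 (schwartzMul f (conjShift γ x)) ξ := by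
  rw [SchwartzMap.fourier_coe, innerSTFT]
  refine congrArg (fun h : V → ℂ => 𝓕 h ξ) (funext fun t => ?_)
  simp

lemma norm_fourier_conjShift (γ : 𝓢(V, ℂ)) (x ξ : V) :
    ‖𝓕 (conjShift γ x) ξ‖ = ‖𝓕 (conjShift γ 0) ξ‖ := by
  rw [SchwartzMap.fourier_coe, SchwartzMap.fourier_coe,
    ← fourier_comp_sub (conjShift γ 0) x]
  refine congrArg (fun h : V → ℂ => ‖𝓕 h ξ‖) (funext fun t => ?_)
  simp

lemma norm_fourier_cross (γ g₀ : 𝓢(V, ℂ)) (x y ξ : V) :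
    ‖𝓕 (fun t => g₀ (t - y) * (starRingEnd ℂ) (γ (t - x))) ξ‖ = ‖innerSTFT γ g₀ (x - y) ξ‖ := by
  rw [innerSTFT, ← fourier_comp_sub (fun t => g₀ t * (starRingEnd ℂ) (γ (t - (x - y)))) y]
  refine congrArg (fun h : V → ℂ => ‖𝓕 h ξ‖) (funext fun t => ?_)
  simp

lemma enorm_eq_of_norm_eq {a b : ℂ} (h : ‖a‖ = ‖b‖) : ‖a‖ₑ = ‖b‖ₑ := by
  rw [← ofReal_norm, ← ofReal_norm, h]

/-- The reproducing inequality of the short-time Fourier transform: changing the window costs a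
convolution with the short-time Fourier transform of the windows. -/
lemma innerSTFT_reproducing (γ g₀ f : 𝓢(V, ℂ)) (x ξ : V) :
    ‖innerSTFT γ f x ξ‖ₑ * ‖∫ t, (starRingEnd ℂ) (g₀ t) * g₀ t‖ₑ ≤
      ∫⁻ y, ∫⁻ η, ‖innerSTFT g₀ f y η‖ₑ * ‖innerSTFT γ g₀ (x - y) (ξ - η)‖ₑ := by
  set F : V → ℂ := fun t => Real.fourierChar (-⟪t, ξ⟫) • (f t * (starRingEnd ℂ) (γ (t - x)))
    with hF
  have hFint : Integrable F := by
    have := (Real.fourierIntegral_convergent_iff (μ := volume) ξ).2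
      (schwartzMul f (conjShift γ x)).integrable
    simpa [hF] using this
  set K : V → ℂ := fun t => (starRingEnd ℂ) (g₀ t) * g₀ t with hK
  have hKint : Integrable K := by
    refine (schwartzMul (conjShift g₀ 0) g₀).integrable.congr (.of_forall fun t => ?_)
    simp [hK]
  have hjoint : Integrable (fun z : V × V => F z.2 * K (z.2 - z.1)) (volume.prod volume) := by
    simpa using hFint.convolution_integrand (ContinuousLinearMap.mul ℂ ℂ) hKint.comp_neg
  have hprod : innerSTFT γ f x ξ * ∫ t, K t = ∫ y, ∫ t, F t * K (t - y) := by
    rw [integral_integral_swap (f := fun y t => F t * K (t - y)) hjoint]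
    have : ∀ t, ∫ y, F t * K (t - y) = F t * ∫ y, K y := fun t => by
      rw [integral_const_mul, integral_sub_left_eq_self K volume t]
    simp_rw [this]
    rw [integral_mul_const]
    rfl
  have hinner (y : V) : ∫ t, F t * K (t - y) =
      ∫ η, innerSTFT g₀ f y η *
        𝓕 (fun t => g₀ (t - y) * (starRingEnd ℂ) (γ (t - x))) (ξ - η) := by
    let g₁ : 𝓢(V, ℂ) := SchwartzMap.compSubConstCLM ℝ y g₀
    have h := fourier_schwartzMul (schwartzMul f (conjShift g₀ y))
      (schwartzMul g₁ (conjShift γ x)) ξ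
    have h1 : 𝓕 (schwartzMul (schwartzMul f (conjShift g₀ y))
        (schwartzMul g₁ (conjShift γ x))) ξ = ∫ t, F t * K (t - y) := by
      rw [SchwartzMap.fourier_coe, Real.fourier_eq]
      congr 1 with t
      simp only [hF, hK, g₁, schwartzMul_apply, conjShift_apply, SchwartzMap.compSubConstCLM_apply,
        Circle.smul_def, smul_eq_mul]
      ring
    rw [← h1, h]
    rfl
  rw [← enorm_mul, hprod]
  refine (enorm_integral_le_lintegral_enorm _).trans (lintegral_mono fun y => ?_)
  rw [hinner]
  refine (enorm_integral_le_lintegral_enorm _).trans (lintegral_mono fun η => ?_)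
  rw [enorm_mul, enorm_eq_of_norm_eq (norm_fourier_cross γ g₀ x y (ξ - η))]

/-- The convolution of two rapidly decaying functions decays rapidly. -/
lemma integral_mul_shift_decay (f g : 𝓢(V, ℂ)) (N : ℕ) :
    ∃ C, 0 < C ∧ ∀ x, (1 + ‖x‖) ^ N * ∫ t, ‖f t‖ * ‖g (x - t)‖ ≤ C := by
  obtain ⟨C, hC, hCb⟩ := schwartz_decay g N
  have hint : Integrable (fun t => (1 + ‖t‖) ^ N * ‖f t‖) := by
    refine ((f.integrable.norm.add (f.integrable_pow_mul volume N)).const_mul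
      (2 ^ (N - 1))).mono' (by fun_prop) (.of_forall fun t => ?_)
    rw [Real.norm_of_nonneg (by positivity)]
    have := add_pow_le zero_le_one (norm_nonneg t) N
    rw [one_pow] at this
    calc (1 + ‖t‖) ^ N * ‖f t‖ ≤ (2 ^ (N - 1) * (1 + ‖t‖ ^ N)) * ‖f t‖ := by gcongr
      _ = _ := by simp only [Pi.add_apply]; ring
  refine ⟨(∫ t, (1 + ‖t‖) ^ N * ‖f t‖) * C + 1, by positivity, fun x => ?_⟩
  rw [← integral_const_mul, ← integral_mul_const]
  refine le_add_of_le_of_nonneg (integral_mono_of_nonneg (.of_forall fun t => by positivity)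
    (hint.mul_const _) (.of_forall fun t => ?_)) zero_le_one
  have h1 : 1 + ‖x‖ ≤ (1 + ‖t‖) * (1 + ‖x - t‖) := by
    have := norm_add_le t (x - t)
    rw [add_sub_cancel] at this
    nlinarith [norm_nonneg t, norm_nonneg (x - t)]
  calc (1 + ‖x‖) ^ N * (‖f t‖ * ‖g (x - t)‖)
      ≤ ((1 + ‖t‖) * (1 + ‖x - t‖)) ^ N * (‖f t‖ * ‖g (x - t)‖) := by gcongr
    _ = ((1 + ‖t‖) ^ N * ‖f t‖) * ((1 + ‖x - t‖) ^ N * ‖g (x - t)‖) := by rw [mul_pow]; ring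
    _ ≤ ((1 + ‖t‖) ^ N * ‖f t‖) * C := by gcongr; exact hCb _

/-- The short-time Fourier transform of Schwartz functions decays rapidly in both variables. -/
lemma innerSTFT_decay (γ f : 𝓢(V, ℂ)) (N : ℕ) :
    ∃ C, 0 < C ∧ ∀ x ξ, ‖innerSTFT γ f x ξ‖ ≤ C * (((1 + ‖x‖) ^ N)⁻¹ * ((1 + ‖ξ‖) ^ N)⁻¹) := by
  let γ' : 𝓢(V, ℂ) := SchwartzMap.compCLMOfContinuousLinearEquiv ℝ
    (ContinuousLinearEquiv.neg ℝ (M := V)) γ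
  obtain ⟨A, hA, hAb⟩ := integral_mul_shift_decay f γ' (2 * N)
  obtain ⟨B, hB, hBb⟩ := integral_mul_shift_decay (𝓕 f) (𝓕 (conjShift γ 0)) (2 * N)
  have h1 (x ξ : V) : (1 + ‖x‖) ^ (2 * N) * ‖innerSTFT γ f x ξ‖ ≤ A := by
    refine le_trans ?_ (hAb x)
    gcongr
    rw [innerSTFT, Real.fourier_eq]
    refine (norm_integral_le_integral_norm _).trans (le_of_eq ?_)
    congr 1 with t
    simp [γ']
  have h2 (x ξ : V) : (1 + ‖ξ‖) ^ (2 * N) * ‖innerSTFT γ f x ξ‖ ≤ B := by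
    refine le_trans ?_ (hBb ξ)
    gcongr
    rw [innerSTFT_eq_fourier, fourier_schwartzMul]
    refine (norm_integral_le_integral_norm _).trans (le_of_eq ?_)
    congr 1 with t
    rw [norm_mul, norm_fourier_conjShift]
  refine ⟨A + B, by positivity, fun x ξ => ?_⟩
  rw [← mul_inv, ← div_eq_mul_inv, le_div_iff₀ (by positivity)]
  have h3 := h1 x ξ
  have h4 := h2 x ξ
  rw [mul_comm 2 N, pow_mul] at h3 h4
  nlinarith [mul_nonneg (norm_nonneg (innerSTFT γ f x ξ))
    (sq_nonneg ((1 + ‖x‖) ^ N - (1 + ‖ξ‖) ^ N)), mul_nonneg (norm_nonneg (innerSTFT γ f x ξ))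
    (sq_nonneg ((1 + ‖x‖) ^ N + (1 + ‖ξ‖) ^ N))]

end FourierSide

section MixedLintegral

variable {X Y W : Type*} [MeasurableSpace X] [MeasurableSpace Y] [MeasurableSpace W]

/-- **Minkowski's integral inequality** for `ℝ≥0∞`-valued functions. -/
lemma lintegral_minkowski (μ : Measure X) (ν : Measure W) [SFinite μ] [SFinite ν]
    {p : ℝ} (hp : 1 ≤ p) {F : X → W → ℝ≥0∞} (hF : Measurable (Function.uncurry F)) :
    (∫⁻ x, (∫⁻ w, F x w ∂ν) ^ p ∂μ) ^ (1 / p) ≤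
      ∫⁻ w, (∫⁻ x, F x w ^ p ∂μ) ^ (1 / p) ∂ν := by
  rcases hp.eq_or_lt with rfl | hp1
  · simp only [ENNReal.rpow_one, div_one]
    exact (lintegral_lintegral_swap hF.aemeasurable).le
  have hp0 : 0 < p := by linarith
  have hFw (x : X) : Measurable (F x) := hF.of_uncurry_left
  have hFx (w : W) : Measurable (fun x => F x w) := hF.of_uncurry_right
  set n : W → ℝ≥0∞ := fun w => (∫⁻ x, F x w ^ p ∂μ) ^ (1 / p) with hn
  have hnm : Measurable n :=
    (Measurable.lintegral_prod_left' (f := fun z : X × W => F z.1 z.2 ^ p)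
      (hF.pow_const p)).pow_const _
  by_cases htop : ∫⁻ w, n w ∂ν = ⊤
  · rw [htop]; exact le_top
  set r : ℝ := p.conjExponent with hr
  have hpr : p.HolderConjugate r := Real.HolderConjugate.conjExponent hp1
  have hr0 : 0 < r := hpr.symm.pos
  have hn_fin : ∀ᵐ w ∂ν, n w < ⊤ := ae_lt_top hnm htop
  have hset : MeasurableSet {z : X × W |
      F z.1 z.2 ≤ n z.2 ^ (1 / r) * (F z.1 z.2 * n z.2 ^ (-(1 / r)))} := by
    have h2 : Measurable fun z : X × W => n z.2 := hnm.comp measurable_snd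
    exact measurableSet_le hF ((h2.pow_const _).mul (hF.mul (h2.pow_const _)))
  have hae : ∀ᵐ x ∂μ, ∀ᵐ w ∂ν, F x w ≤ n w ^ (1 / r) * (F x w * n w ^ (-(1 / r))) := by
    rw [Measure.ae_ae_comm hset]
    filter_upwards [hn_fin] with w hw
    by_cases h0 : n w = 0
    · have h1 : ∫⁻ x, F x w ^ p ∂μ = 0 := by
        rw [hn] at h0
        exact (ENNReal.rpow_eq_zero_iff_of_pos (by positivity)).1 h0
      rw [lintegral_eq_zero_iff ((hFx w).pow_const p)] at h1
      filter_upwards [h1] with x hx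
      have : F x w = 0 := (ENNReal.rpow_eq_zero_iff_of_pos hp0).1 hx
      simp [this]
    · refine .of_forall fun x => le_of_eq ?_
      rw [mul_left_comm, ← ENNReal.rpow_add _ _ h0 hw.ne, add_neg_cancel, ENNReal.rpow_zero,
        mul_one]
  have hexp : p / r = p - 1 := by
    rw [hr, Real.conjExponent]; field_simp
  have hbound : ∀ᵐ x ∂μ, (∫⁻ w, F x w ∂ν) ^ p ≤
      (∫⁻ w, n w ∂ν) ^ (p / r) * ∫⁻ w, F x w ^ p * n w ^ (-(p / r)) ∂ν := by
    filter_upwards [hae] with x hx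
    have h1 : ∫⁻ w, F x w ∂ν ≤ (∫⁻ w, n w ∂ν) ^ (1 / r) *
        (∫⁻ w, F x w ^ p * n w ^ (-(p / r)) ∂ν) ^ (1 / p) := by
      refine (lintegral_mono_ae hx).trans ?_
      refine (ENNReal.lintegral_mul_le_Lp_mul_Lq ν hpr.symm (hnm.pow_const _).aemeasurable
        ((hFw x).mul (hnm.pow_const _)).aemeasurable).trans (le_of_eq ?_)
      congr 2
      · refine lintegral_congr fun w => ?_
        rw [← ENNReal.rpow_mul, one_div, inv_mul_cancel₀ hr0.ne', ENNReal.rpow_one]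
      · refine lintegral_congr fun w => ?_
        rw [Pi.mul_apply, ENNReal.mul_rpow_of_nonneg _ _ hp0.le, ← ENNReal.rpow_mul]
        congr 2
        ring
    refine (ENNReal.rpow_le_rpow h1 hp0.le).trans (le_of_eq ?_)
    rw [ENNReal.mul_rpow_of_nonneg _ _ hp0.le, ← ENNReal.rpow_mul, ← ENNReal.rpow_mul, one_div,
      one_div, inv_mul_cancel₀ hp0.ne', ENNReal.rpow_one, div_eq_inv_mul]
  have hmain : ∫⁻ x, (∫⁻ w, F x w ∂ν) ^ p ∂μ ≤ (∫⁻ w, n w ∂ν) ^ p := by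
    calc ∫⁻ x, (∫⁻ w, F x w ∂ν) ^ p ∂μ
        ≤ ∫⁻ x, (∫⁻ w, n w ∂ν) ^ (p / r) * ∫⁻ w, F x w ^ p * n w ^ (-(p / r)) ∂ν ∂μ :=
          lintegral_mono_ae hbound
      _ = (∫⁻ w, n w ∂ν) ^ (p / r) * ∫⁻ x, ∫⁻ w, F x w ^ p * n w ^ (-(p / r)) ∂ν ∂μ := by
          rw [lintegral_const_mul']
          exact ENNReal.rpow_ne_top_of_nonneg (by rw [hexp]; linarith) htop
      _ = (∫⁻ w, n w ∂ν) ^ (p / r) * ∫⁻ w, (∫⁻ x, F x w ^ p ∂μ) * n w ^ (-(p / r)) ∂ν := by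
          rw [lintegral_lintegral_swap]
          · congr 1
            refine lintegral_congr fun w => ?_
            rw [lintegral_mul_const _ ((hFx w).pow_const p)]
          · exact ((hF.pow_const p).mul
              ((hnm.comp measurable_snd).pow_const _)).aemeasurable
      _ ≤ (∫⁻ w, n w ∂ν) ^ (p / r) * ∫⁻ w, n w ∂ν := by
          gcongr with w
          have h1 : ∫⁻ x, F x w ^ p ∂μ = n w ^ p := by
            rw [hn, ← ENNReal.rpow_mul, one_div, inv_mul_cancel₀ hp0.ne', ENNReal.rpow_one]
          rw [h1, hexp]
          rcases eq_or_ne (n w) 0 with h0 | h0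
          · simp [h0, hp0]
          rcases eq_or_ne (n w) ⊤ with h2 | h2
          · simp [h2]
          · rw [← ENNReal.rpow_add _ _ h0 h2]
            simp
      _ = (∫⁻ w, n w ∂ν) ^ p := by
          rcases eq_or_ne (∫⁻ w, n w ∂ν) 0 with h0 | h0
          · simp [h0, hp0]
          · nth_rewrite 2 [← ENNReal.rpow_one (∫⁻ w, n w ∂ν)]
            rw [← ENNReal.rpow_add _ _ h0 htop, hexp, sub_add_cancel]
  calc (∫⁻ x, (∫⁻ w, F x w ∂ν) ^ p ∂μ) ^ (1 / p)
      ≤ ((∫⁻ w, n w ∂ν) ^ p) ^ (1 / p) := ENNReal.rpow_le_rpow hmain (by positivity)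
    _ = ∫⁻ w, n w ∂ν := by
        rw [← ENNReal.rpow_mul, one_div, mul_inv_cancel₀ hp0.ne', ENNReal.rpow_one]

/-- The mixed `L^{p,q}` norm of an `ℝ≥0∞`-valued function, with the inner norm taken in the first
variable. -/
noncomputable def lmixed (μ : Measure X) (ν : Measure Y) (p q : ℝ) (H : X → Y → ℝ≥0∞) : ℝ≥0∞ :=
  (∫⁻ y, (∫⁻ x, H x y ^ p ∂μ) ^ (q / p) ∂ν) ^ (1 / q)

variable {μ : Measure X} {ν : Measure Y} {p q : ℝ}

lemma lmixed_mono (hp : 1 ≤ p) (hq : 1 ≤ q) {H H' : X → Y → ℝ≥0∞} (h : ∀ x y, H x y ≤ H' x y) :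
    lmixed μ ν p q H ≤ lmixed μ ν p q H' := by
  have : 0 ≤ q / p := by positivity
  unfold lmixed
  gcongr
  exact h _ _

lemma lmixed_const_mul (hp : 1 ≤ p) (hq : 1 ≤ q) {c : ℝ≥0∞} (hc : c ≠ ⊤) (H : X → Y → ℝ≥0∞) :
    lmixed μ ν p q (fun x y => c * H x y) = c * lmixed μ ν p q H := by
  have hp0 : 0 < p := by linarith
  have hq0 : 0 < q := by linarith
  have hqp : 0 ≤ q / p := by positivity
  have h1 (y : Y) : (∫⁻ x, (c * H x y) ^ p ∂μ) ^ (q / p) =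
      c ^ q * (∫⁻ x, H x y ^ p ∂μ) ^ (q / p) := by
    simp_rw [ENNReal.mul_rpow_of_nonneg _ _ hp0.le]
    rw [lintegral_const_mul' _ _ (ENNReal.rpow_ne_top_of_nonneg hp0.le hc),
      ENNReal.mul_rpow_of_nonneg _ _ hqp, ← ENNReal.rpow_mul, mul_div_cancel₀ _ hp0.ne']
  unfold lmixed
  simp_rw [h1]
  rw [lintegral_const_mul' _ _ (ENNReal.rpow_ne_top_of_nonneg hq0.le hc),
    ENNReal.mul_rpow_of_nonneg _ _ (by positivity), ← ENNReal.rpow_mul, mul_one_div_cancel hq0.ne',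
    ENNReal.rpow_one]

/-- The mixed norm of a tensor product is finite as soon as both factors have finite norm. -/
lemma lmixed_mul_lt_top (hp : 1 ≤ p) (hq : 1 ≤ q) {a : X → ℝ≥0∞} {b : Y → ℝ≥0∞}
    (ha : ∫⁻ x, a x ^ p ∂μ ≠ ⊤) (hb' : ∀ y, b y ≠ ⊤) (hb : ∫⁻ y, b y ^ q ∂ν ≠ ⊤) :
    lmixed μ ν p q (fun x y => b y * a x) < ⊤ := by
  have hp0 : 0 < p := by linarith
  have hq0 : 0 < q := by linarith
  have hqp : 0 ≤ q / p := by positivity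
  have h1 (y : Y) : (∫⁻ x, (b y * a x) ^ p ∂μ) ^ (q / p) =
      b y ^ q * (∫⁻ x, a x ^ p ∂μ) ^ (q / p) := by
    simp_rw [ENNReal.mul_rpow_of_nonneg _ _ hp0.le]
    rw [lintegral_const_mul' _ _ (ENNReal.rpow_ne_top_of_nonneg hp0.le (hb' y)),
      ENNReal.mul_rpow_of_nonneg _ _ hqp, ← ENNReal.rpow_mul, mul_div_cancel₀ _ hp0.ne']
  have h2 : (∫⁻ x, a x ^ p ∂μ) ^ (q / p) ≠ ⊤ := ENNReal.rpow_ne_top_of_nonneg hqp ha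
  unfold lmixed
  simp_rw [h1]
  rw [lintegral_mul_const' _ _ h2]
  exact ENNReal.rpow_lt_top_of_nonneg (by positivity) (ENNReal.mul_ne_top hb h2)

/-- Minkowski's integral inequality for the mixed norm. -/
lemma lmixed_lintegral_le [SFinite μ] [SFinite ν] (ρ : Measure W) [SFinite ρ]
    (hp : 1 ≤ p) (hq : 1 ≤ q) {H : W → X → Y → ℝ≥0∞}
    (hH : Measurable fun z : W × X × Y => H z.1 z.2.1 z.2.2) :
    lmixed μ ν p q (fun x y => ∫⁻ w, H w x y ∂ρ) ≤ ∫⁻ w, lmixed μ ν p q (H w) ∂ρ := by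
  have hp0 : 0 < p := by linarith
  have hq0 : 0 < q := by linarith
  have key (A : ℝ≥0∞) : A ^ (q / p) = (A ^ (1 / p)) ^ q := by
    rw [← ENNReal.rpow_mul]; congr 1; ring
  unfold lmixed
  simp_rw [key]
  calc (∫⁻ y, ((∫⁻ x, (∫⁻ w, H w x y ∂ρ) ^ p ∂μ) ^ (1 / p)) ^ q ∂ν) ^ (1 / q)
      ≤ (∫⁻ y, (∫⁻ w, (∫⁻ x, H w x y ^ p ∂μ) ^ (1 / p) ∂ρ) ^ q ∂ν) ^ (1 / q) := by
        gcongr with y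
        refine lintegral_minkowski μ ρ hp (F := fun x w => H w x y) ?_
        exact hH.comp (measurable_snd.prodMk (measurable_fst.prodMk measurable_const))
    _ ≤ ∫⁻ w, (∫⁻ y, ((∫⁻ x, H w x y ^ p ∂μ) ^ (1 / p)) ^ q ∂ν) ^ (1 / q) ∂ρ := by
        refine lintegral_minkowski ν ρ hq
          (F := fun y w => (∫⁻ x, H w x y ^ p ∂μ) ^ (1 / p)) ?_
        refine Measurable.pow_const ?_ _
        refine Measurable.lintegral_prod_right'
          (f := fun z : (Y × W) × X => H z.1.2 z.2 z.1.1 ^ p) ?_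
        exact (hH.comp ((measurable_snd.comp measurable_fst).prodMk
          (measurable_snd.prodMk (measurable_fst.comp measurable_fst)))).pow_const p

/-- **Young's inequality** for the mixed norm. -/
lemma lmixed_convolution_le {G : Type*} [MeasurableSpace G] [AddCommGroup G] [MeasurableAdd₂ G]
    [MeasurableNeg G] (μ : Measure G) [SFinite μ] [μ.IsAddLeftInvariant] [μ.IsNegInvariant]
    (hp : 1 ≤ p) (hq : 1 ≤ q) {H K : G → G → ℝ≥0∞}
    (hH : Measurable (Function.uncurry H)) (hK : Measurable (Function.uncurry K))
    (hK' : ∀ x y, K x y ≠ ⊤) :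
    lmixed μ μ p q (fun x ξ => ∫⁻ y, ∫⁻ η, H y η * K (x - y) (ξ - η) ∂μ ∂μ) ≤
      (∫⁻ y, ∫⁻ η, K y η ∂μ ∂μ) * lmixed μ μ p q H := by
  have hsub (x ξ : G) : ∫⁻ y, ∫⁻ η, H y η * K (x - y) (ξ - η) ∂μ ∂μ =
      ∫⁻ y, ∫⁻ η, K y η * H (x - y) (ξ - η) ∂μ ∂μ := by
    rw [← lintegral_sub_left_eq_self _ x]
    refine lintegral_congr fun y => ?_
    rw [← lintegral_sub_left_eq_self _ ξ]
    refine lintegral_congr fun η => ?_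
    rw [sub_sub_cancel, sub_sub_cancel, mul_comm]
  have htrans (y η : G) : lmixed μ μ p q (fun x ξ => K y η * H (x - y) (ξ - η)) =
      K y η * lmixed μ μ p q H := by
    rw [lmixed_const_mul hp hq (hK' y η)]
    congr 1
    unfold lmixed
    rw [lintegral_sub_right_eq_self
      (fun ξ => (∫⁻ x, H (x - y) ξ ^ p ∂μ) ^ (q / p)) η]
    congr 2 with ξ
    rw [lintegral_sub_right_eq_self (fun x => H x ξ ^ p) y]
  have hmeas : Measurable fun z : (G × G × G) × G =>
      K z.1.1 z.2 * H (z.1.2.1 - z.1.1) (z.1.2.2 - z.2) := by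
    have h1 : Measurable fun z : (G × G × G) × G => (z.1.1, z.2) := by fun_prop
    have h2 : Measurable fun z : (G × G × G) × G => (z.1.2.1 - z.1.1, z.1.2.2 - z.2) := by
      fun_prop
    exact (hK.comp h1).mul (hH.comp h2)
  simp_rw [hsub]
  calc lmixed μ μ p q (fun x ξ => ∫⁻ y, ∫⁻ η, K y η * H (x - y) (ξ - η) ∂μ ∂μ)
      ≤ ∫⁻ y, lmixed μ μ p q (fun x ξ => ∫⁻ η, K y η * H (x - y) (ξ - η) ∂μ) ∂μ :=
        lmixed_lintegral_le μ hp hq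
          (H := fun y x ξ => ∫⁻ η, K y η * H (x - y) (ξ - η) ∂μ) hmeas.lintegral_prod_right'
    _ ≤ ∫⁻ y, ∫⁻ η, lmixed μ μ p q (fun x ξ => K y η * H (x - y) (ξ - η)) ∂μ ∂μ := by
        refine lintegral_mono fun y => lmixed_lintegral_le μ hp hq
          (H := fun η x ξ => K y η * H (x - y) (ξ - η)) ?_
        have h3 : Measurable fun z : G × G × G =>
            (((y, z.2.1, z.2.2), z.1) : (G × G × G) × G) := by fun_prop
        exact hmeas.comp h3
    _ = (∫⁻ y, ∫⁻ η, K y η ∂μ ∂μ) * lmixed μ μ p q H := by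
        simp_rw [htrans]
        have h1 (y : G) : ∫⁻ η, K y η * lmixed μ μ p q H ∂μ =
            (∫⁻ η, K y η ∂μ) * lmixed μ μ p q H :=
          lintegral_mul_const _ hK.of_uncurry_left
        simp_rw [h1]
        exact lintegral_mul_const _ hK.lintegral_prod_right'

end MixedLintegral

section Transfer

variable {d : ℕ}

/-- A Schwartz function on `ℝᵈ` seen as a Schwartz function on Euclidean space. -/
noncomputable def onEuclidean (f : 𝓢(Fin d → ℝ, ℂ)) : 𝓢(EuclideanSpace ℝ (Fin d), ℂ) :=
  SchwartzMap.compCLMOfContinuousLinearEquiv ℝ (EuclideanSpace.equiv (Fin d) ℝ) f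

@[simp]
lemma onEuclidean_apply (f : 𝓢(Fin d → ℝ, ℂ)) (t : EuclideanSpace ℝ (Fin d)) :
    onEuclidean f t = f t.ofLp := rfl

lemma integral_comp_toLp (F : EuclideanSpace ℝ (Fin d) → ℂ) :
    ∫ t : Fin d → ℝ, F (WithLp.toLp 2 t) = ∫ t, F t :=
  (PiLp.volume_preserving_toLp (Fin d)).integral_comp
    (MeasurableEquiv.toLp 2 _).measurableEmbedding F

lemma lintegral_comp_toLp (F : EuclideanSpace ℝ (Fin d) → ℝ≥0∞) :
    ∫⁻ t : Fin d → ℝ, F (WithLp.toLp 2 t) = ∫⁻ t, F t :=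
  (PiLp.volume_preserving_toLp (Fin d)).lintegral_comp_emb
    (MeasurableEquiv.toLp 2 _).measurableEmbedding F

lemma STFT_eq_innerSTFT (γ f : 𝓢(Fin d → ℝ, ℂ)) (x ξ : Fin d → ℝ) :
    STFT γ f x ξ =
      innerSTFT (onEuclidean γ) (onEuclidean f) (WithLp.toLp 2 x) (WithLp.toLp 2 ξ) := by
  rw [innerSTFT, Real.fourier_eq', ← integral_comp_toLp, STFT]
  refine integral_congr_ae (.of_forall fun t => ?_)
  simp only [onEuclidean_apply, WithLp.ofLp_sub, EuclideanSpace.inner_eq_star_dotProduct,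
    star_trivial, smul_eq_mul]
  rw [mul_comm]
  congr 2
  push_cast
  rw [dotProduct_comm]
  ring

/-- The pointwise change of window inequality for the short-time Fourier transform. -/
lemma STFT_reproducing (γ g₀ f : 𝓢(Fin d → ℝ, ℂ)) (x ξ : Fin d → ℝ) :
    ‖STFT γ f x ξ‖ₑ * ‖∫ t, (starRingEnd ℂ) (g₀ t) * g₀ t‖ₑ ≤
      ∫⁻ y, ∫⁻ η, ‖STFT g₀ f y η‖ₑ * ‖STFT γ g₀ (x - y) (ξ - η)‖ₑ := by
  simp only [STFT_eq_innerSTFT, WithLp.toLp_sub]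
  have h := innerSTFT_reproducing (onEuclidean γ) (onEuclidean g₀) (onEuclidean f)
    (WithLp.toLp 2 x) (WithLp.toLp 2 ξ)
  rw [← integral_comp_toLp, ← lintegral_comp_toLp] at h
  simp only [← lintegral_comp_toLp (d := d) (fun η => ‖innerSTFT _ _ _ η‖ₑ * _)] at h
  exact h

lemma norm_le_norm_toLp (x : Fin d → ℝ) : ‖x‖ ≤ ‖WithLp.toLp 2 x‖ := by
  refine (pi_norm_le_iff_of_nonneg (norm_nonneg _)).2 fun i => ?_
  exact PiLp.norm_apply_le (WithLp.toLp 2 x) i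

lemma STFT_decay (γ f : 𝓢(Fin d → ℝ, ℂ)) (N : ℕ) :
    ∃ C, 0 < C ∧ ∀ x ξ, ‖STFT γ f x ξ‖ ≤ C * (((1 + ‖x‖) ^ N)⁻¹ * ((1 + ‖ξ‖) ^ N)⁻¹) := by
  obtain ⟨C, hC, h⟩ := innerSTFT_decay (onEuclidean γ) (onEuclidean f) N
  refine ⟨C, hC, fun x ξ => ?_⟩
  rw [STFT_eq_innerSTFT]
  refine (h _ _).trans ?_
  have h1 := norm_le_norm_toLp x
  have h2 := norm_le_norm_toLp ξ
  gcongr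

lemma continuous_STFT (γ f : 𝓢(Fin d → ℝ, ℂ)) :
    Continuous (Function.uncurry (STFT γ f)) := by
  obtain ⟨C, -, hC⟩ := γ.decay 0 0
  simp only [pow_zero, norm_iteratedFDeriv_zero, one_mul] at hC
  refine continuous_of_dominated (bound := fun t => ‖f t‖ * C) (fun z => ?_)
    (fun z => .of_forall fun t => ?_) (f.integrable.norm.mul_const C) (.of_forall fun t => ?_)
  · have hf := f.continuous
    have hγ := γ.continuous
    refine Continuous.aestronglyMeasurable ?_
    fun_prop
  · rw [norm_mul, norm_mul, RCLike.norm_conj]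
    have : ‖Complex.exp (-2 * Real.pi * Complex.I * ((z.2 ⬝ᵥ t : ℝ) : ℂ))‖ = 1 := by
      rw [Complex.norm_exp]; simp
    rw [this, mul_one]
    gcongr
    exact hC _
  · have hγ := γ.continuous
    fun_prop

end Transfer

section WeightedNorm

variable {d : ℕ}

/-- The modulus of `F` multiplied by the weight `m`, as an extended nonnegative function. -/
noncomputable def weighted (m : (Fin d → ℝ) × (Fin d → ℝ) → ℝ)
    (F : (Fin d → ℝ) → (Fin d → ℝ) → ℂ) (x ξ : Fin d → ℝ) : ℝ≥0∞ :=
  ‖F x ξ‖ₑ * ENNReal.ofReal (m (x, ξ))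

lemma measurable_weighted {m : (Fin d → ℝ) × (Fin d → ℝ) → ℝ}
    {F : (Fin d → ℝ) → (Fin d → ℝ) → ℂ} (hm : Continuous m)
    (hF : Continuous (Function.uncurry F)) :
    Measurable (Function.uncurry (weighted m F)) :=
  hF.measurable.enorm.mul hm.measurable.ennreal_ofReal

lemma weighted_ne_top (m : (Fin d → ℝ) × (Fin d → ℝ) → ℝ)
    (F : (Fin d → ℝ) → (Fin d → ℝ) → ℂ) (x ξ : Fin d → ℝ) : weighted m F x ξ ≠ ⊤ :=
  ENNReal.mul_ne_top enorm_ne_top ENNReal.ofReal_ne_top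

/-- If the mixed norm is finite, then it agrees with its extended nonnegative counterpart. -/
lemma mixedNorm_eq_toReal {p q : ℝ} (hp : 1 ≤ p) (hq : 1 ≤ q)
    {m : (Fin d → ℝ) × (Fin d → ℝ) → ℝ} {F : (Fin d → ℝ) → (Fin d → ℝ) → ℂ}
    (hm_pos : ∀ z, 0 < m z) (hm : Continuous m) (hF : Continuous (Function.uncurry F))
    (hfin : lmixed volume volume p q (weighted m F) < ⊤) :
    mixedNorm p q m F = (lmixed volume volume p q (weighted m F)).toReal := by
  have hp0 : 0 < p := by linarith
  have hq0 : 0 < q := by linarith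
  have hmeas := measurable_weighted hm hF
  have hinner (ξ : Fin d → ℝ) : ∫ x, ‖F x ξ‖ ^ p * m (x, ξ) ^ p =
      (∫⁻ x, weighted m F x ξ ^ p).toReal := by
    have hc : Continuous fun x => ‖F x ξ‖ ^ p * m (x, ξ) ^ p := by
      have h1 : Continuous fun x => F x ξ := hF.comp (by fun_prop : Continuous fun x => (x, ξ))
      have h2 : Continuous fun x => m (x, ξ) := hm.comp (by fun_prop)
      exact (h1.norm.rpow_const fun _ => .inr hp0.le).mul (h2.rpow_const fun _ => .inr hp0.le)
    rw [integral_eq_lintegral_of_nonneg_ae _ hc.aestronglyMeasurable]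
    · congr 1
      refine lintegral_congr fun x => ?_
      rw [weighted, ← ofReal_norm, ENNReal.mul_rpow_of_nonneg _ _ hp0.le,
        ENNReal.ofReal_rpow_of_nonneg (norm_nonneg _) hp0.le,
        ENNReal.ofReal_rpow_of_nonneg (hm_pos _).le hp0.le, ENNReal.ofReal_mul (by positivity)]
    · exact .of_forall fun x => mul_nonneg (by positivity) (Real.rpow_nonneg (hm_pos _).le _)
  have hImeas : Measurable fun ξ => (∫⁻ x, weighted m F x ξ ^ p) ^ (q / p) :=
    (Measurable.lintegral_prod_left' (f := fun z : (Fin d → ℝ) × (Fin d → ℝ) =>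
      weighted m F z.1 z.2 ^ p) (hmeas.pow_const p)).pow_const _
  have hne : ∫⁻ ξ, (∫⁻ x, weighted m F x ξ ^ p) ^ (q / p) ≠ ⊤ := fun h => by
    rw [lmixed, h, ENNReal.top_rpow_of_pos (by positivity)] at hfin
    exact hfin.ne rfl
  unfold mixedNorm lmixed
  simp_rw [hinner, ENNReal.toReal_rpow]
  rw [integral_toReal hImeas.aemeasurable (ae_lt_top hImeas hne), ENNReal.toReal_rpow]

/-- A weight of at most polynomial growth. -/
def PolyBounded (w : (Fin d → ℝ) × (Fin d → ℝ) → ℝ) : Prop :=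
  ∃ (D : ℝ) (N : ℕ), 0 < D ∧ ∀ x ξ, w (x, ξ) ≤ D * ((1 + ‖x‖) ^ N * (1 + ‖ξ‖) ^ N)

lemma PolyBounded.const_mul {w : (Fin d → ℝ) × (Fin d → ℝ) → ℝ} (hw : PolyBounded w) {c : ℝ}
    (hc : 0 < c) : PolyBounded fun z => c * w z := by
  obtain ⟨D, N, hD, h⟩ := hw
  refine ⟨c * D, N, by positivity, fun x ξ => ?_⟩
  rw [mul_assoc]
  exact mul_le_mul_of_nonneg_left (h x ξ) hc.le

lemma PolyBounded.mono {w w' : (Fin d → ℝ) × (Fin d → ℝ) → ℝ} (hw : PolyBounded w)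
    (h : ∀ z, w' z ≤ w z) : PolyBounded w' := by
  obtain ⟨D, N, hD, hb⟩ := hw
  exact ⟨D, N, hD, fun x ξ => (h _).trans (hb x ξ)⟩

lemma polyBounded_of_le_rpow {w : (Fin d → ℝ) × (Fin d → ℝ) → ℝ} {D N : ℝ} (hD : 0 < D)
    (h : ∀ z, w z ≤ D * (1 + ‖z‖) ^ N) : PolyBounded w := by
  refine ⟨D, ⌈N⌉₊, hD, fun x ξ => (h _).trans ?_⟩
  rw [← mul_pow]
  have h1 : 1 + ‖(x, ξ)‖ ≤ (1 + ‖x‖) * (1 + ‖ξ‖) := by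
    have := mul_nonneg (norm_nonneg x) (norm_nonneg ξ)
    have : ‖(x, ξ)‖ ≤ ‖x‖ + ‖ξ‖ := by
      rw [Prod.norm_mk]
      exact max_le_add_of_nonneg (norm_nonneg x) (norm_nonneg ξ)
    linarith
  gcongr
  calc (1 + ‖(x, ξ)‖) ^ N ≤ (1 + ‖(x, ξ)‖) ^ (⌈N⌉₊ : ℝ) :=
        Real.rpow_le_rpow_of_exponent_le (by linarith [norm_nonneg (x, ξ)]) (Nat.le_ceil N)
    _ = (1 + ‖(x, ξ)‖) ^ ⌈N⌉₊ := Real.rpow_natCast _ _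
    _ ≤ ((1 + ‖x‖) * (1 + ‖ξ‖)) ^ ⌈N⌉₊ := by gcongr

/-- An integrable function that bounds rapidly decaying functions on `ℝᵈ`. -/
noncomputable def japaneseDecay (x : Fin d → ℝ) : ℝ≥0∞ :=
  ENNReal.ofReal ((1 + ‖x‖) ^ (-((d : ℝ) + 1)))

lemma lintegral_japaneseDecay_rpow_lt_top {r : ℝ} (hr : 1 ≤ r) :
    ∫⁻ x : Fin d → ℝ, japaneseDecay x ^ r < ⊤ := by
  refine lt_of_le_of_lt (lintegral_mono fun x => ?_)
    (finite_integral_one_add_norm (E := Fin d → ℝ) (μ := volume) (r := (d : ℝ) + 1) (by simp))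
  have h1 : japaneseDecay x ≤ 1 := by
    rw [japaneseDecay, ← ENNReal.ofReal_one]
    refine ENNReal.ofReal_le_ofReal (Real.rpow_le_one_of_one_le_of_nonpos ?_ ?_)
    · linarith [norm_nonneg x]
    · linarith [(Nat.cast_nonneg d : (0 : ℝ) ≤ d)]
  calc japaneseDecay x ^ r ≤ japaneseDecay x ^ (1 : ℝ) := ENNReal.rpow_le_rpow_of_exponent_ge h1 hr
    _ = japaneseDecay x := ENNReal.rpow_one _

/-- Weighted short-time Fourier transforms of Schwartz functions decay rapidly. -/
lemma weighted_STFT_le {w : (Fin d → ℝ) × (Fin d → ℝ) → ℝ} (hw : PolyBounded w)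
    (γ f : 𝓢(Fin d → ℝ, ℂ)) :
    ∃ C : ℝ≥0∞, C ≠ ⊤ ∧ ∀ x ξ, weighted w (STFT γ f) x ξ ≤
      C * (japaneseDecay ξ * japaneseDecay x) := by
  obtain ⟨D, N, hD, hDw⟩ := hw
  obtain ⟨C, hC, hCf⟩ := STFT_decay γ f (N + (d + 1))
  have hpow (x : Fin d → ℝ) : (1 + ‖x‖) ^ (-((d : ℝ) + 1)) = ((1 + ‖x‖) ^ (d + 1))⁻¹ := by
    rw [Real.rpow_neg (by positivity)]
    norm_cast
  refine ⟨ENNReal.ofReal (C * D), ENNReal.ofReal_ne_top, fun x ξ => ?_⟩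
  rw [weighted, japaneseDecay, japaneseDecay, ← ofReal_norm, ← ENNReal.ofReal_mul (by positivity),
    ← ENNReal.ofReal_mul (by positivity), ← ENNReal.ofReal_mul (by positivity), hpow, hpow]
  refine ENNReal.ofReal_le_ofReal ?_
  calc ‖STFT γ f x ξ‖ * w (x, ξ)
      ≤ ‖STFT γ f x ξ‖ * (D * ((1 + ‖x‖) ^ N * (1 + ‖ξ‖) ^ N)) := by
        gcongr; exact hDw x ξ
    _ ≤ (C * (((1 + ‖x‖) ^ (N + (d + 1)))⁻¹ * ((1 + ‖ξ‖) ^ (N + (d + 1)))⁻¹)) *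
          (D * ((1 + ‖x‖) ^ N * (1 + ‖ξ‖) ^ N)) := by
        gcongr; exact hCf x ξ
    _ = C * D * (((1 + ‖ξ‖) ^ (d + 1))⁻¹ * ((1 + ‖x‖) ^ (d + 1))⁻¹) := by
        have h1 : (1 + ‖x‖) ≠ 0 := by positivity
        have h2 : (1 + ‖ξ‖) ≠ 0 := by positivity
        rw [pow_add, pow_add]
        field_simp
        ring

lemma lmixed_weighted_STFT_lt_top {p q : ℝ} (hp : 1 ≤ p) (hq : 1 ≤ q)
    {w : (Fin d → ℝ) × (Fin d → ℝ) → ℝ} (hw : PolyBounded w) (γ f : 𝓢(Fin d → ℝ, ℂ)) :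
    lmixed volume volume p q (weighted w (STFT γ f)) < ⊤ := by
  obtain ⟨C, hC, h⟩ := weighted_STFT_le hw γ f
  refine (lmixed_mono hp hq h).trans_lt ?_
  rw [lmixed_const_mul hp hq hC]
  exact ENNReal.mul_lt_top hC.lt_top (lmixed_mul_lt_top hp hq
    (lintegral_japaneseDecay_rpow_lt_top hp).ne (fun _ => ENNReal.ofReal_ne_top)
    (lintegral_japaneseDecay_rpow_lt_top hq).ne)

lemma lintegral_weighted_STFT_lt_top {w : (Fin d → ℝ) × (Fin d → ℝ) → ℝ} (hw : PolyBounded w)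
    (hw_cont : Continuous w) (γ f : 𝓢(Fin d → ℝ, ℂ)) :
    ∫⁻ x, ∫⁻ ξ, weighted w (STFT γ f) x ξ < ⊤ := by
  have h := lmixed_weighted_STFT_lt_top le_rfl le_rfl hw γ f
  simp only [lmixed, ENNReal.rpow_one, div_one] at h
  rwa [lintegral_lintegral_swap (measurable_weighted hw_cont (continuous_STFT γ f)).aemeasurable]

lemma enorm_window_ne_zero {g₀ : 𝓢(Fin d → ℝ, ℂ)} (hg₀ : g₀ ≠ 0) :
    ‖∫ t, (starRingEnd ℂ) (g₀ t) * g₀ t‖ₑ ≠ 0 := by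
  have h1 (t : Fin d → ℝ) : (starRingEnd ℂ) (g₀ t) * g₀ t = ((‖g₀ t‖ ^ 2 : ℝ) : ℂ) := by
    rw [mul_comm, Complex.mul_conj']; norm_cast
  simp_rw [h1]
  rw [integral_complex_ofReal, enorm_ne_zero, Ne, Complex.ofReal_eq_zero]
  obtain ⟨t, ht⟩ : ∃ t, g₀ t ≠ 0 := by
    by_contra! h
    exact hg₀ (by ext t; simpa using h t)
  have hint : Integrable fun t => ‖g₀ t‖ ^ 2 := by
    have := g₀.memLp 2 (μ := volume)
    exact (memLp_two_iff_integrable_sq_norm g₀.continuous.aestronglyMeasurable).1 this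
  refine (integral_pos_of_integrable_nonneg_nonzero (x := t) ?_ hint
    (fun _ => by positivity) ?_).ne'
  · exact g₀.continuous.norm.pow 2
  · simpa using ht

/-- Changing the window of the short-time Fourier transform yields an equivalent norm. -/
lemma lmixed_change_window {p q : ℝ} (hp : 1 ≤ p) (hq : 1 ≤ q)
    {v m : (Fin d → ℝ) × (Fin d → ℝ) → ℝ} {C₁ : ℝ} (hC₁ : 0 < C₁) (hv_pos : ∀ z, 0 < v z)
    (hv_cont : Continuous v) (hv_poly : PolyBounded v) (hm_cont : Continuous m)
    (hm_mod : ∀ z w, m (z + w) ≤ C₁ * v z * m w)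
    (γ : 𝓢(Fin d → ℝ, ℂ)) {g₀ : 𝓢(Fin d → ℝ, ℂ)} (hg₀ : g₀ ≠ 0) :
    ∃ B : ℝ≥0∞, B ≠ ⊤ ∧ ∀ f : 𝓢(Fin d → ℝ, ℂ),
      lmixed volume volume p q (weighted m (STFT γ f)) ≤
        B * lmixed volume volume p q (weighted m (STFT g₀ f)) := by
  set κ := ‖∫ t, (starRingEnd ℂ) (g₀ t) * g₀ t‖ₑ with hκ
  have hκ0 : κ ≠ 0 := enorm_window_ne_zero hg₀
  have hκt : κ ≠ ⊤ := enorm_ne_top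
  set u : (Fin d → ℝ) × (Fin d → ℝ) → ℝ := fun z => C₁ * v z with hu
  have hu_cont : Continuous u := continuous_const.mul hv_cont
  have hu_poly : PolyBounded u := hv_poly.const_mul hC₁
  set I := ∫⁻ x, ∫⁻ ξ, weighted u (STFT γ g₀) x ξ with hI
  have hI_top : I < ⊤ := lintegral_weighted_STFT_lt_top hu_poly hu_cont γ g₀
  refine ⟨κ⁻¹ * I, ENNReal.mul_ne_top (ENNReal.inv_ne_top.2 hκ0) hI_top.ne, fun f => ?_⟩
  have hpt (x ξ : Fin d → ℝ) : κ * weighted m (STFT γ f) x ξ ≤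
      ∫⁻ y, ∫⁻ η, weighted m (STFT g₀ f) y η * weighted u (STFT γ g₀) (x - y) (ξ - η) := by
    calc κ * weighted m (STFT γ f) x ξ
        = (‖STFT γ f x ξ‖ₑ * κ) * ENNReal.ofReal (m (x, ξ)) := by rw [weighted]; ring
      _ ≤ (∫⁻ y, ∫⁻ η, ‖STFT g₀ f y η‖ₑ * ‖STFT γ g₀ (x - y) (ξ - η)‖ₑ) *
            ENNReal.ofReal (m (x, ξ)) := by
          gcongr; exact STFT_reproducing γ g₀ f x ξ
      _ = ∫⁻ y, ∫⁻ η, ‖STFT g₀ f y η‖ₑ * ‖STFT γ g₀ (x - y) (ξ - η)‖ₑ *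
            ENNReal.ofReal (m (x, ξ)) := by
          rw [← lintegral_mul_const' _ _ ENNReal.ofReal_ne_top]
          simp_rw [← lintegral_mul_const' _ _ ENNReal.ofReal_ne_top]
      _ ≤ _ := by
          refine lintegral_mono fun y => lintegral_mono fun η => ?_
          have h1 : m (x, ξ) ≤ u (x - y, ξ - η) * m (y, η) := by
            simpa using hm_mod (x - y, ξ - η) (y, η)
          have h2 := ENNReal.ofReal_le_ofReal h1
          rw [ENNReal.ofReal_mul (mul_pos hC₁ (hv_pos _)).le] at h2
          calc _ ≤ ‖STFT g₀ f y η‖ₑ * ‖STFT γ g₀ (x - y) (ξ - η)‖ₑ *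
                (ENNReal.ofReal (u (x - y, ξ - η)) * ENNReal.ofReal (m (y, η))) :=
                mul_le_mul' le_rfl h2
            _ = _ := by simp only [weighted]; ring
  have h := (lmixed_mono hp hq hpt).trans (lmixed_convolution_le volume hp hq
    (measurable_weighted hm_cont (continuous_STFT g₀ f))
    (measurable_weighted hu_cont (continuous_STFT γ g₀)) (weighted_ne_top _ _))
  rw [lmixed_const_mul hp hq hκt] at h
  rw [mul_assoc, ← ENNReal.mul_le_iff_le_inv hκ0 hκt]
  exact h

end WeightedNorm

section LinearChange

variable {d : ℕ}

/-- The continuous linear automorphism of `ℝᵈ` given by an invertible matrix. -/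
noncomputable def matrixEquiv (M : Matrix (Fin d) (Fin d) ℝ) (hM : IsUnit M) :
    (Fin d → ℝ) ≃L[ℝ] (Fin d → ℝ) :=
  (Matrix.toLinearEquiv' M hM.invertible).toContinuousLinearEquiv

lemma map_matrixEquiv_volume (M : Matrix (Fin d) (Fin d) ℝ) (hM : IsUnit M) :
    Measure.map (matrixEquiv M hM).toHomeomorph.toMeasurableEquiv volume =
      ENNReal.ofReal |M.det⁻¹| • (volume : Measure (Fin d → ℝ)) :=
  Real.map_matrix_volume_pi_eq_smul_volume_pi ((M.isUnit_iff_isUnit_det.1 hM).ne_zero)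

lemma lintegral_comp_mulVec {M : Matrix (Fin d) (Fin d) ℝ} (hM : IsUnit M)
    (F : (Fin d → ℝ) → ℝ≥0∞) :
    ∫⁻ x, F (M *ᵥ x) = ENNReal.ofReal |M.det⁻¹| * ∫⁻ x, F x := by
  have h := lintegral_map_equiv (μ := volume) F (matrixEquiv M hM).toHomeomorph.toMeasurableEquiv
  rw [map_matrixEquiv_volume, lintegral_smul_measure, smul_eq_mul] at h
  exact h.symm

lemma integral_comp_mulVec {M : Matrix (Fin d) (Fin d) ℝ} (hM : IsUnit M)
    (F : (Fin d → ℝ) → ℂ) :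
    ∫ x, F (M *ᵥ x) = (|M.det⁻¹| : ℝ) * ∫ x, F x := by
  have h := integral_map_equiv (μ := volume) (matrixEquiv M hM).toHomeomorph.toMeasurableEquiv F
  rw [map_matrixEquiv_volume, integral_smul_measure, ENNReal.toReal_ofReal (abs_nonneg _),
    Complex.real_smul] at h
  exact h.symm

/-- Linear changes of variables in each argument rescale the mixed norm. -/
lemma exists_lmixed_comp_mulVec {p q : ℝ} (hp : 1 ≤ p) (hq : 1 ≤ q)
    {P Q : Matrix (Fin d) (Fin d) ℝ} (hP : IsUnit P) (hQ : IsUnit Q) :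
    ∃ J : ℝ≥0∞, J ≠ 0 ∧ J ≠ ⊤ ∧ ∀ H : (Fin d → ℝ) → (Fin d → ℝ) → ℝ≥0∞,
      lmixed volume volume p q (fun x ξ => H (P *ᵥ x) (Q *ᵥ ξ)) =
        J * lmixed volume volume p q H := by
  have hqp : 0 ≤ q / p := by positivity
  have hq1 : 0 ≤ 1 / q := by positivity
  have hdet {M : Matrix (Fin d) (Fin d) ℝ} (hM : IsUnit M) : ENNReal.ofReal |M.det⁻¹| ≠ 0 := by
    have := (M.isUnit_iff_isUnit_det.1 hM).ne_zero
    rw [Ne, ENNReal.ofReal_eq_zero, not_le]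
    positivity
  have hatop : ENNReal.ofReal |P.det⁻¹| ^ (q / p) ≠ ⊤ :=
    ENNReal.rpow_ne_top_of_nonneg hqp ENNReal.ofReal_ne_top
  refine ⟨(ENNReal.ofReal |P.det⁻¹| ^ (q / p) * ENNReal.ofReal |Q.det⁻¹|) ^ (1 / q), ?_,
    ENNReal.rpow_ne_top_of_nonneg hq1 (ENNReal.mul_ne_top hatop ENNReal.ofReal_ne_top),
    fun H => ?_⟩
  · refine (ENNReal.rpow_pos (pos_iff_ne_zero.2 (mul_ne_zero ?_ (hdet hQ)))
      (ENNReal.mul_ne_top hatop ENNReal.ofReal_ne_top)).ne'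
    exact (ENNReal.rpow_pos (pos_iff_ne_zero.2 (hdet hP)) ENNReal.ofReal_ne_top).ne'
  · have h1 (ξ : Fin d → ℝ) : (∫⁻ x, H (P *ᵥ x) (Q *ᵥ ξ) ^ p) ^ (q / p) =
        ENNReal.ofReal |P.det⁻¹| ^ (q / p) * (∫⁻ x, H x (Q *ᵥ ξ) ^ p) ^ (q / p) := by
      rw [lintegral_comp_mulVec hP fun x => H x (Q *ᵥ ξ) ^ p, ENNReal.mul_rpow_of_nonneg _ _ hqp]
    unfold lmixed
    simp_rw [h1]
    rw [lintegral_const_mul' _ _ hatop,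
      lintegral_comp_mulVec hQ fun ξ => (∫⁻ x, H x ξ ^ p) ^ (q / p), ← mul_assoc,
      ENNReal.mul_rpow_of_nonneg _ _ hq1]

/-- The modulus of a Wigner-decomposable distribution is that of a short-time Fourier transform
after a linear change of variables. -/
lemma norm_WCE {E11 E12 E21 E22 : Matrix (Fin d) (Fin d) ℝ} (h12 : IsUnit E12) (h22 : IsUnit E22)
    (C : Matrix (Fin d ⊕ Fin d) (Fin d ⊕ Fin d) ℝ) (f g : (Fin d → ℝ) → ℂ) (x ξ : Fin d → ℝ) :
    ‖WCE C E11 E12 E21 E22 f g x ξ‖ =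
      (Real.sqrt |(Matrix.fromBlocks E11 E12 E21 E22).det| * |E12.det⁻¹|) *
        ‖STFT (fun y => g ((E22 * E12⁻¹) *ᵥ y)) f ((E11 - E12 * E22⁻¹ * E21) *ᵥ x)
          ((E12ᵀ)⁻¹ *ᵥ ξ)‖ := by
  have hd12 := E12.isUnit_iff_isUnit_det.1 h12
  have hd22 := E22.isUnit_iff_isUnit_det.1 h22
  have hd12t : IsUnit E12ᵀ.det := by rwa [det_transpose]
  set P := E11 - E12 * E22⁻¹ * E21 with hP
  set η := (E12ᵀ)⁻¹ *ᵥ ξ with hη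
  set G : (Fin d → ℝ) → ℂ := fun s => f s *
    (starRingEnd ℂ) (g ((E22 * E12⁻¹) *ᵥ (s - P *ᵥ x))) *
      Complex.exp (-2 * Real.pi * Complex.I * ((η ⬝ᵥ s : ℝ) : ℂ)) with hG
  set c : ℂ := Complex.exp (2 * Real.pi * Complex.I * ((η ⬝ᵥ (E11 *ᵥ x) : ℝ) : ℂ)) with hc
  have hdot (t : Fin d → ℝ) : η ⬝ᵥ (E12 *ᵥ t) = ξ ⬝ᵥ t := by
    rw [dotProduct_mulVec, ← mulVec_transpose, hη, mulVec_mulVec, mul_nonsing_inv _ hd12t,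
      one_mulVec]
  have harg (t : Fin d → ℝ) : (E22 * E12⁻¹) *ᵥ (E12 *ᵥ t + E11 *ᵥ x - P *ᵥ x) =
      E21 *ᵥ x + E22 *ᵥ t := by
    have h1 : E22 * E12⁻¹ * E12 = E22 := nonsing_inv_mul_cancel_right _ _ hd12
    have h2 : E22 * E12⁻¹ * (E12 * E22⁻¹ * E21) = E21 := by
      rw [← Matrix.mul_assoc, ← Matrix.mul_assoc, h1, mul_nonsing_inv _ hd22, Matrix.one_mul]
    have h3 : E12 *ᵥ t + E11 *ᵥ x - P *ᵥ x = E12 *ᵥ t + (E12 * E22⁻¹ * E21) *ᵥ x := by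
      rw [hP, sub_mulVec]; abel
    rw [h3, mulVec_add, mulVec_mulVec, mulVec_mulVec, h1, h2, add_comm]
  have hint : ∫ t : Fin d → ℝ, f (E11 *ᵥ x + E12 *ᵥ t) *
      (starRingEnd ℂ) (g (E21 *ᵥ x + E22 *ᵥ t)) *
        Complex.exp (-2 * Real.pi * Complex.I * ((ξ ⬝ᵥ t : ℝ) : ℂ)) =
      c * ((|E12.det⁻¹| : ℝ) * ∫ s, G s) := by
    rw [← integral_add_right_eq_self G (E11 *ᵥ x),
      ← integral_comp_mulVec h12 fun s => G (s + E11 *ᵥ x), ← integral_const_mul]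
    refine integral_congr_ae (.of_forall fun t => ?_)
    simp only [hG, hc]
    rw [harg, dotProduct_add, hdot, add_comm (E12 *ᵥ t), mul_left_comm, ← Complex.exp_add]
    congr 2
    push_cast
    ring
  have hchirp : ‖Complex.exp (Complex.I * Real.pi * (chirpQ C x ξ : ℝ))‖ = 1 := by
    rw [Complex.norm_exp]; simp
  have hc1 : ‖c‖ = 1 := by
    rw [hc, Complex.norm_exp]; simp
  rw [WCE, WE, hint, norm_mul, hchirp, one_mul, norm_mul, norm_mul, hc1, one_mul, norm_mul,
    Complex.norm_real, Complex.norm_real, Real.norm_of_nonneg (Real.sqrt_nonneg _),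
    Real.norm_of_nonneg (abs_nonneg _), ← mul_assoc]
  rfl

lemma isUnit_schur {E11 E12 E21 E22 : Matrix (Fin d) (Fin d) ℝ} (h22 : IsUnit E22)
    (hE : IsUnit (Matrix.fromBlocks E11 E12 E21 E22)) : IsUnit (E11 - E12 * E22⁻¹ * E21) := by
  let := h22.invertible
  rw [← invOf_eq_nonsing_inv]
  exact isUnit_fromBlocks_iff_of_invertible₂₂.1 hE

lemma mixedNorm_congr_norm {p q : ℝ} {m : (Fin d → ℝ) × (Fin d → ℝ) → ℝ}
    {F F' : (Fin d → ℝ) → (Fin d → ℝ) → ℂ} (h : ∀ x ξ, ‖F x ξ‖ = ‖F' x ξ‖) :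
    mixedNorm p q m F = mixedNorm p q m F' := by
  simp only [mixedNorm, h]

/-- Precomposing the two arguments of `F` with linear maps that leave the weight `m` invariant
up to constants yields an equivalent mixed norm. -/
lemma exists_lmixed_weighted_comp {p q : ℝ} (hp : 1 ≤ p) (hq : 1 ≤ q)
    {m : (Fin d → ℝ) × (Fin d → ℝ) → ℝ} {P Q : Matrix (Fin d) (Fin d) ℝ} (hP : IsUnit P)
    (hQ : IsUnit Q) {c₀ c₁ k : ℝ} (hc₀ : 0 < c₀) (hc₁ : 0 < c₁) (hk : 0 < k)
    (hm : ∀ x ξ, c₀ * m (x, ξ) ≤ m (P *ᵥ x, Q *ᵥ ξ) ∧ m (P *ᵥ x, Q *ᵥ ξ) ≤ c₁ * m (x, ξ)) :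
    ∃ a b : ℝ≥0∞, a ≠ ⊤ ∧ b ≠ ⊤ ∧ ∀ F F' : (Fin d → ℝ) → (Fin d → ℝ) → ℂ,
      (∀ x ξ, ‖F' x ξ‖ = k * ‖F (P *ᵥ x) (Q *ᵥ ξ)‖) →
      lmixed volume volume p q (weighted m F) ≤ a * lmixed volume volume p q (weighted m F') ∧
      lmixed volume volume p q (weighted m F') ≤ b * lmixed volume volume p q (weighted m F) := by
  obtain ⟨J, hJ0, hJt, hJ⟩ := exists_lmixed_comp_mulVec hp hq hP hQ
  have hne {c : ℝ} (hc : 0 < c) : ENNReal.ofReal c ≠ 0 := (ENNReal.ofReal_pos.2 hc).ne'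
  have ht {c : ℝ} : ENNReal.ofReal c ≠ ⊤ := ENNReal.ofReal_ne_top
  set κ := ENNReal.ofReal k * J with hκ
  have hκ0 : κ ≠ 0 := mul_ne_zero (hne hk) hJ0
  have hκt : κ ≠ ⊤ := ENNReal.mul_ne_top ht hJt
  refine ⟨κ⁻¹ * ENNReal.ofReal c₁, (ENNReal.ofReal c₀)⁻¹ * κ,
    ENNReal.mul_ne_top (ENNReal.inv_ne_top.2 hκ0) ht,
    ENNReal.mul_ne_top (ENNReal.inv_ne_top.2 (hne hc₀)) hκt, fun F F' hF => ?_⟩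
  have hF' (x ξ : Fin d → ℝ) : ‖F' x ξ‖ₑ = ENNReal.ofReal k * ‖F (P *ᵥ x) (Q *ᵥ ξ)‖ₑ := by
    rw [← ofReal_norm, hF, ENNReal.ofReal_mul hk.le, ofReal_norm]
  have hcomp : lmixed volume volume p q
      (fun x ξ => ENNReal.ofReal k * weighted m F (P *ᵥ x) (Q *ᵥ ξ)) =
        κ * lmixed volume volume p q (weighted m F) := by
    rw [lmixed_const_mul hp hq ht, hJ, mul_assoc]
  constructor
  · rw [mul_assoc, ← ENNReal.mul_le_iff_le_inv hκ0 hκt, ← hcomp, ← lmixed_const_mul hp hq ht]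
    refine lmixed_mono hp hq fun x ξ => ?_
    have h := ENNReal.ofReal_le_ofReal (hm x ξ).2
    rw [ENNReal.ofReal_mul hc₁.le] at h
    calc _ ≤ ENNReal.ofReal k * (‖F (P *ᵥ x) (Q *ᵥ ξ)‖ₑ *
          (ENNReal.ofReal c₁ * ENNReal.ofReal (m (x, ξ)))) := by
            unfold weighted; gcongr
      _ = _ := by rw [weighted, hF']; ring
  · rw [mul_assoc, ← ENNReal.mul_le_iff_le_inv (hne hc₀) ht, ← hcomp, ← lmixed_const_mul hp hq ht]
    refine lmixed_mono hp hq fun x ξ => ?_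
    have h := ENNReal.ofReal_le_ofReal (hm x ξ).1
    rw [ENNReal.ofReal_mul hc₀.le] at h
    calc _ = ENNReal.ofReal k * (‖F (P *ᵥ x) (Q *ᵥ ξ)‖ₑ *
          (ENNReal.ofReal c₀ * ENNReal.ofReal (m (x, ξ)))) := by rw [weighted, hF']; ring
      _ ≤ _ := by unfold weighted; gcongr

end LinearChange

theorem WCE_characterizes_modulation_spaces {d : ℕ} (hd : 1 ≤ d)
    (E11 E12 E21 E22 : Matrix (Fin d) (Fin d) ℝ)
    (h12 : IsUnit E12) (h22 : IsUnit E22)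
    (hE : IsUnit (Matrix.fromBlocks E11 E12 E21 E22))
    (C : Matrix (Fin d ⊕ Fin d) (Fin d ⊕ Fin d) ℝ) (hC : C.IsSymm)
    (p q : ℝ) (hp : 1 ≤ p) (hq : 1 ≤ q)
    (v : (Fin d → ℝ) × (Fin d → ℝ) → ℝ)
    (hv_pos : ∀ z, 0 < v z) (hv_cont : Continuous v)
    (hv_even : ∀ z, v (-z) = v z)
    (hv_submult : ∀ z w, v (z + w) ≤ v z * v w)
    (hv_poly : ∃ C₀ N : ℝ, 0 < C₀ ∧ 0 < N ∧ ∀ z, v z ≤ C₀ * (1 + ‖z‖) ^ N)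
    (m : (Fin d → ℝ) × (Fin d → ℝ) → ℝ)
    (hm_pos : ∀ z, 0 < m z) (hm_cont : Continuous m)
    (hm_mod : ∃ C₁ : ℝ, 0 < C₁ ∧ ∀ z w, m (z + w) ≤ C₁ * v z * m w)
    (hm_inv : ∃ c₀ c₁ : ℝ, 0 < c₀ ∧ 0 < c₁ ∧ ∀ x ξ : Fin d → ℝ,
      c₀ * m (x, ξ) ≤ m ((E11 - E12 * E22⁻¹ * E21) *ᵥ x, (E12ᵀ)⁻¹ *ᵥ ξ) ∧
      m ((E11 - E12 * E22⁻¹ * E21) *ᵥ x, (E12ᵀ)⁻¹ *ᵥ ξ) ≤ c₁ * m (x, ξ))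
    (g₀ g : SchwartzMap (Fin d → ℝ) ℂ) (hg₀ : g₀ ≠ 0) (hg : g ≠ 0) :
    ∃ A B : ℝ, 0 < A ∧ 0 < B ∧ ∀ f : SchwartzMap (Fin d → ℝ) ℂ,
      A * mixedNorm p q m (STFT g₀ f) ≤
          mixedNorm p q m (WCE C E11 E12 E21 E22 f g) ∧
        mixedNorm p q m (WCE C E11 E12 E21 E22 f g) ≤
          B * mixedNorm p q m (STFT g₀ f) := by
  obtain ⟨C₁, hC₁, hmod⟩ := hm_mod
  obtain ⟨c₀, c₁, hc₀, hc₁, hinv⟩ := hm_inv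
  obtain ⟨C₀, N, hC₀, -, hv_le⟩ := hv_poly
  have hv_poly : PolyBounded v := polyBounded_of_le_rpow hC₀ hv_le
  have hm_poly : PolyBounded m := by
    refine (hv_poly.const_mul (mul_pos hC₁ (hm_pos 0))).mono fun z => ?_
    calc m z ≤ C₁ * v z * m 0 := by simpa using hmod z 0
      _ = C₁ * m 0 * v z := by ring
  have hd12 := E12.isUnit_iff_isUnit_det.1 h12
  have hS : IsUnit (E22 * E12⁻¹) := h22.mul ((isUnit_nonsing_inv_iff).2 h12)
  have hQ : IsUnit (E12ᵀ)⁻¹ := isUnit_nonsing_inv_iff.2 ((isUnit_transpose _).2 h12)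
  have hP := isUnit_schur h22 hE
  set P := E11 - E12 * E22⁻¹ * E21
  set Q := (E12ᵀ)⁻¹
  set k := Real.sqrt |(Matrix.fromBlocks E11 E12 E21 E22).det| * |E12.det⁻¹| with hk_def
  have hk : 0 < k := by
    have h1 := hd12.ne_zero
    have h2 := ((isUnit_iff_isUnit_det _).1 hE).ne_zero
    positivity
  set e := matrixEquiv (E22 * E12⁻¹) hS
  set γ : 𝓢(Fin d → ℝ, ℂ) := SchwartzMap.compCLMOfContinuousLinearEquiv ℝ e g with hγ_def
  have hγ : γ ≠ 0 := by
    intro h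
    refine hg (SchwartzMap.ext fun y => ?_)
    have := DFunLike.congr_fun h (e.symm y)
    simpa [hγ_def] using this
  obtain ⟨B₁, hB₁, h₁⟩ := lmixed_change_window hp hq hC₁ hv_pos hv_cont hv_poly hm_cont hmod γ hg₀
  obtain ⟨B₂, hB₂, h₂⟩ := lmixed_change_window hp hq hC₁ hv_pos hv_cont hv_poly hm_cont hmod g₀ hγ
  obtain ⟨a, b, ha, hb, hab⟩ := exists_lmixed_weighted_comp hp hq hP hQ hc₀ hc₁ hk hinv
  refine ⟨((B₂ * a).toReal + 1)⁻¹, (b * B₁).toReal + 1, by positivity, by positivity,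
    fun f => ?_⟩
  set F' : (Fin d → ℝ) → (Fin d → ℝ) → ℂ := fun x ξ => k * STFT γ f (P *ᵥ x) (Q *ᵥ ξ) with hF'
  have hnorm (x ξ : Fin d → ℝ) : ‖F' x ξ‖ = k * ‖STFT γ f (P *ᵥ x) (Q *ᵥ ξ)‖ := by
    rw [hF', norm_mul, Complex.norm_real, Real.norm_of_nonneg hk.le]
  have hF'_cont : Continuous (Function.uncurry F') := by
    have h := (continuous_STFT γ f).comp (by fun_prop :
      Continuous fun z : (Fin d → ℝ) × (Fin d → ℝ) => (P *ᵥ z.1, Q *ᵥ z.2))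
    exact continuous_const.mul h
  obtain ⟨hab₁, hab₂⟩ := hab _ F' hnorm
  have hfin₀ := lmixed_weighted_STFT_lt_top hp hq hm_poly g₀ f
  have hfinγ := lmixed_weighted_STFT_lt_top hp hq hm_poly γ f
  have hfin := hab₂.trans_lt (ENNReal.mul_lt_top hb.lt_top hfinγ)
  have hW : mixedNorm p q m (WCE C E11 E12 E21 E22 f g) = mixedNorm p q m F' :=
    mixedNorm_congr_norm fun x ξ => (norm_WCE h12 h22 C f g x ξ).trans (hnorm x ξ).symm
  rw [hW, mixedNorm_eq_toReal hp hq hm_pos hm_cont (continuous_STFT g₀ f) hfin₀,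
    mixedNorm_eq_toReal hp hq hm_pos hm_cont hF'_cont hfin]
  constructor
  · have h := ENNReal.toReal_mono (ENNReal.mul_ne_top (ENNReal.mul_ne_top hB₂ ha) hfin.ne)
      ((h₂ f).trans (mul_le_mul' le_rfl hab₁) |>.trans_eq (mul_assoc _ _ _).symm)
    rw [ENNReal.toReal_mul] at h
    rw [inv_mul_le_iff₀ (by positivity)]
    exact h.trans (by gcongr; linarith)
  · have h := ENNReal.toReal_mono (ENNReal.mul_ne_top (ENNReal.mul_ne_top hb hB₁) hfin₀.ne)
      (hab₂.trans (mul_le_mul' le_rfl (h₁ f)) |>.trans_eq (mul_assoc _ _ _).symm)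
    rw [ENNReal.toReal_mul] at h
    exact h.trans (by gcongr; linarith)
end
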